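/- Let δ > 0 be sufficiently small, γ > 1/2 + 2δ, and let η₀ > 0 be a sufficiently small constant. There is a constant C (depending on γ, δ, η₀ and on the coefficients α of the bilinear form Q) such that for all 0 < T ≤ 1, λ ≥ 10, N₁ = λT^{−1/2}, and all f, g with finite ‖·‖_{L^∞_T(H^γ)} and ‖·‖_{X_T} norms: ‖ t^{δ/2} 1_{|ξ| ≥ 0.1N₁} |ξ|^{δ+1/2} e^{λ(t/√T)|ξ| − λ²t/(4T)} ∫₀^t e^{−(t−s)|ξ|²} (Q(f,g))^(s,ξ) ds ‖_{L^∞_T(L²_ξ)} ≤ C [ (e^{4η₀λ²} + λ^{−δ}) λ^{−(γ−1/2+δ)} T^{(γ−1/2+2δ)/2} ( ‖f‖_{L^∞_T(H^γ)} ‖g_h‖_{L^∞_T(H^γ)} + ‖f_h‖_{L^∞_T(H^γ)} ‖g‖_{L^∞_T(H^γ)} ) + λ^{−δ} e^{λ²/4} ‖f‖_{X_T} ‖g‖_{X_T} + λ^{2−δ} T^{δ/2} ( 1 + λ^{1/2+δ+γ} T^{(γ−1/2−δ)/2} e^{0.01λ²} ) ( ‖g‖_{L^∞_T(H^γ)}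 ‖f‖_{X_T} + ‖f‖_{L^∞_T(H^γ)} ‖g‖_{X_T} ) ]. -/

import Mathlib

noncomputable section

open MeasureTheory Set Filter
open scoped ENNReal Topology

/-- Frequency space ℝ³ (as functions `Fin 3 → ℝ`, with the product Lebesgue measure). -/
abbrev V3 : Type := Fin 3 → ℝ

/-- The Euclidean norm on `V3`. -/
def en (ξ : V3) : ℝ := Real.sqrt (∑ i, ξ i ^ 2)

/-- Squared Euclidean magnitude of a vector in ℂ³. -/
def vnSq (v : Fin 3 → ℂ) : ℝ := ∑ j, ‖v j‖ ^ 2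

/-- Weighted L²-norm in the frequency variable, valued in `ℝ≥0∞`:
`wnorm w f = ( ∫ (w ξ)² |f ξ|² dξ )^{1/2}`. -/
def wnorm (w : V3 → ℝ) (f : V3 → Fin 3 → ℂ) : ℝ≥0∞ :=
  (∫⁻ ξ : V3, ENNReal.ofReal (w ξ ^ 2 * vnSq (f ξ))) ^ ((1 : ℝ) / 2)

/-- Weight of the inhomogeneous Sobolev norm `H^γ`, i.e. `⟨ξ⟩^γ`. -/
def wH (γ : ℝ) : V3 → ℝ := fun ξ => (1 + en ξ ^ 2) ^ (γ / 2)

/-- Weight of the homogeneous Sobolev norm `Ḣ^s`, i.e. `|ξ|^s`. -/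
def wD (s : ℝ) : V3 → ℝ := fun ξ => en ξ ^ s

/-- Coefficients `α^{j,m,n,p}_{k,ℓ}` of the bilinear form `Q`
(order of arguments: `α j m n p k l`). -/
abbrev Coeffs : Type := Fin 3 → Fin 3 → Fin 3 → Fin 3 → Fin 3 → Fin 3 → ℝ

/-- The symbol `q^{j,m}_{k,ℓ}(ξ) = Σ_{n,p} α^{j,m,n,p}_{k,ℓ} ξ_n ξ_p / |ξ|²`. -/
def qsym (α : Coeffs) (j m k l : Fin 3) (ξ : V3) : ℝ :=
  ∑ n, ∑ p, α j m n p k l * (ξ n * ξ p) / en ξ ^ 2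

/-- Fourier side of the bilinear term `Q(u,v)`: with the convention
`f̂(ξ) = ∫ f(x) e^{-ix·ξ} dx`, the product `u^k v^ℓ` has Fourier transform
`(2π)⁻³ (û^k ∗ v̂^ℓ)(ξ)`, so that
`(Q^j(u,v))^(ξ) = Σ_{k,ℓ,m} q^{j,m}_{k,ℓ}(ξ) · iξ_m · (2π)⁻³ (û^k ∗ v̂^ℓ)(ξ)`. -/
def Qhat (α : Coeffs) (U W : V3 → Fin 3 → ℂ) : V3 → Fin 3 → ℂ := fun ξ j =>
  ∑ k : Fin 3, ∑ l : Fin 3, ∑ m : Fin 3,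
    (qsym α j m k l ξ : ℂ) * (Complex.I * (ξ m : ℂ)) *
      ((((2 * Real.pi) ^ (3 : ℕ))⁻¹ : ℝ) : ℂ) * ∫ η : V3, U η k * W (ξ - η) l

/-- `U` is (the Fourier transform of) a mild solution of the generalized Navier–Stokes
equations on `[0,T]` with (Fourier-side) data `U₀`:
`û(t,ξ) = e^{-t|ξ|²} û₀(ξ) + ∫₀^t e^{-(t-s)|ξ|²} (Q(u,u))^(s,ξ) ds`. -/
def IsMildSol (α : Coeffs) (U₀ : V3 → Fin 3 → ℂ) (U : ℝ → V3 → Fin 3 → ℂ) (T : ℝ) : Prop :=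
  ∀ t ∈ Icc (0 : ℝ) T, ∀ ξ : V3, ∀ j : Fin 3,
    U t ξ j = (Real.exp (-(t * en ξ ^ 2)) : ℂ) * U₀ ξ j
      + ∫ s in (0 : ℝ)..t, (Real.exp (-((t - s) * en ξ ^ 2)) : ℂ) * Qhat α (U s) (U s) ξ j

/-- Continuity on `[0,T]` with values in the weighted L²-space with weight `w`
(this encodes `u ∈ C([0,T]; H)` for the corresponding Sobolev space `H`). -/
def ContInW (w : V3 → ℝ) (U : ℝ → V3 → Fin 3 → ℂ) (T : ℝ) : Prop :=
  (∀ t ∈ Icc (0 : ℝ) T, wnorm w (U t) < ⊤) ∧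
  ∀ t ∈ Icc (0 : ℝ) T, ∀ ε : ℝ≥0∞, 0 < ε → ∃ d > (0 : ℝ), ∀ s ∈ Icc (0 : ℝ) T,
    |s - t| < d → wnorm w (fun ξ j => U s ξ j - U t ξ j) < ε

/-- Membership in `L²((0,T); H)` for the weighted space `H` with weight `w`. -/
def MemL2W (w : V3 → ℝ) (U : ℝ → V3 → Fin 3 → ℂ) (T : ℝ) : Prop :=
  ∫⁻ t in Ioo (0 : ℝ) T, wnorm w (U t) ^ (2 : ℕ) < ⊤

/-- Joint measurability of a time-dependent (Fourier-side) vector field. -/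
def MeasVF (U : ℝ → V3 → Fin 3 → ℂ) : Prop :=
  ∀ j : Fin 3, Measurable (Function.uncurry fun t ξ => U t ξ j)

/-- Divergence-free condition on the Fourier side: `ξ · û₀(ξ) = 0`. -/
def DivFree (U₀ : V3 → Fin 3 → ℂ) : Prop := ∀ ξ : V3, ∑ j : Fin 3, (ξ j : ℂ) * U₀ ξ j = 0

/-- `U₀` is the Fourier transform of a real (ℝ³-valued) vector field. -/
def RealField (U₀ : V3 → Fin 3 → ℂ) : Prop :=
  ∀ ξ : V3, ∀ j : Fin 3, U₀ (-ξ) j = (starRingEnd ℂ) (U₀ ξ j)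

/-- The working norm `X_T` from \eqref{S1eq3}. -/
def Xnorm (δ lam T : ℝ) (A : ℝ → V3 → Fin 3 → ℂ) : ℝ≥0∞ :=
  ⨆ t ∈ Icc (0 : ℝ) T,
    wnorm (fun ξ => if 0.01 * (lam * T ^ (-(1 : ℝ) / 2)) ≤ en ξ then
        t ^ (δ / 2) * en ξ ^ (δ + 1 / 2) *
          Real.exp (-(lam ^ 2 * t / (4 * T)) + lam * t / Real.sqrt T * en ξ)
      else 0) (A t)

/-- The `L^∞_T(H^γ)` norm. -/
def supH (γ T : ℝ) (A : ℝ → V3 → Fin 3 → ℂ) : ℝ≥0∞ :=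
  ⨆ t ∈ Icc (0 : ℝ) T, wnorm (wH γ) (A t)

/-- High-frequency part `a_h`, cut at `0.01 N`. -/
def highPart (N : ℝ) (A : ℝ → V3 → Fin 3 → ℂ) : ℝ → V3 → Fin 3 → ℂ :=
  fun t ξ j => if 0.01 * N ≤ en ξ then A t ξ j else 0

/-- The L² norm of an `ℝ≥0∞`-valued function on frequency space. -/
def l2n (h : V3 → ℝ≥0∞) : ℝ≥0∞ := (∫⁻ ξ, h ξ ^ (2 : ℝ)) ^ ((1 : ℝ) / 2)

lemma l2n_mono {f g : V3 → ℝ≥0∞} (h : ∀ ξ, f ξ ≤ g ξ) : l2n f ≤ l2n g := by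
  unfold l2n
  gcongr with ξ
  exact h ξ

lemma l2n_const_mul {f : V3 → ℝ≥0∞} (c : ℝ≥0∞) (hf : Measurable f) :
    l2n (fun ξ => c * f ξ) = c * l2n f := by
  unfold l2n
  simp_rw [ENNReal.mul_rpow_of_nonneg _ _ (zero_le_two : (0 : ℝ) ≤ 2)]
  rw [lintegral_const_mul _ (by fun_prop), ENNReal.mul_rpow_of_nonneg _ _ (by norm_num),
    ← ENNReal.rpow_mul]
  norm_num

lemma l2n_add_le {f g : V3 → ℝ≥0∞} (hf : Measurable f) (hg : Measurable g) :
    l2n (fun ξ => f ξ + g ξ) ≤ l2n f + l2n g :=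
  ENNReal.lintegral_Lp_add_le hf.aemeasurable hg.aemeasurable one_le_two

lemma lintegral_mul_le_l2n {f g : V3 → ℝ≥0∞} (hf : Measurable f) (hg : Measurable g) :
    ∫⁻ ξ, f ξ * g ξ ≤ l2n f * l2n g :=
  ENNReal.lintegral_mul_le_Lp_mul_Lq volume Real.HolderConjugate.two_two
    hf.aemeasurable hg.aemeasurable

lemma l2n_rpow_two (f : V3 → ℝ≥0∞) : l2n f ^ (2 : ℝ) = ∫⁻ ξ, f ξ ^ (2 : ℝ) := by
  unfold l2n
  rw [← ENNReal.rpow_mul]; norm_num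

lemma le_of_rpow_two_le {a b : ℝ≥0∞} (h : a ^ (2 : ℝ) ≤ b ^ (2 : ℝ)) : a ≤ b :=
  (ENNReal.rpow_le_rpow_iff (by norm_num : (0 : ℝ) < 2)).1 h

lemma measurable_l2n {β : Type*} [MeasurableSpace β] {K : β → V3 → ℝ≥0∞}
    (hK : Measurable (Function.uncurry K)) : Measurable (fun s => l2n (K s)) := by
  unfold l2n
  apply Measurable.pow_const
  apply Measurable.lintegral_prod_right' (f := fun p : β × V3 => K p.1 p.2 ^ (2 : ℝ))
  exact Measurable.pow_const hK _

/-- Minkowski's integral inequality. -/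
lemma l2n_lintegral_le {β : Type*} [MeasurableSpace β] {μ : Measure β} [SFinite μ]
    {K : β → V3 → ℝ≥0∞} (hK : Measurable (Function.uncurry K)) :
    l2n (fun ξ => ∫⁻ s, K s ξ ∂μ) ≤ ∫⁻ s, l2n (K s) ∂μ := by
  apply le_of_rpow_two_le
  rw [l2n_rpow_two]
  have hKs : ∀ s, Measurable (K s) := fun s => hK.comp (measurable_const.prodMk measurable_id)
  have hKx : ∀ ξ, Measurable (fun s => K s ξ) := fun ξ =>
    hK.comp (measurable_id.prodMk measurable_const)
  have hL := measurable_l2n hK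
  have hI : Measurable (fun ξ => ∫⁻ s, K s ξ ∂μ) :=
    Measurable.lintegral_prod_right' (f := fun p : V3 × β => K p.2 p.1)
      (hK.comp measurable_swap)
  calc ∫⁻ ξ, (∫⁻ s, K s ξ ∂μ) ^ (2 : ℝ)
      = ∫⁻ ξ, ∫⁻ s, K s ξ * (∫⁻ s', K s' ξ ∂μ) ∂μ := by
        refine lintegral_congr fun ξ => ?_
        rw [lintegral_mul_const _ (hKx ξ), ENNReal.rpow_two, sq]
    _ = ∫⁻ s, (∫⁻ ξ, K s ξ * (∫⁻ s', K s' ξ ∂μ)) ∂μ := by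
        rw [lintegral_lintegral_swap]
        apply Measurable.aemeasurable
        exact (hK.comp measurable_swap).mul (hI.comp measurable_fst)
    _ = ∫⁻ s, (∫⁻ s', (∫⁻ ξ, K s ξ * K s' ξ) ∂μ) ∂μ := by
        refine lintegral_congr fun s => ?_
        rw [lintegral_lintegral_swap]
        · refine lintegral_congr fun ξ => ?_
          rw [lintegral_const_mul _ (hKx ξ)]
        · apply Measurable.aemeasurable
          exact ((hKs s).comp measurable_snd).mul hK
    _ ≤ ∫⁻ s, (∫⁻ s', l2n (K s) * l2n (K s') ∂μ) ∂μ := by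
        gcongr with s s'
        exact lintegral_mul_le_l2n (hKs s) (hKs s')
    _ = (∫⁻ s, l2n (K s) ∂μ) ^ (2 : ℝ) := by
        simp_rw [lintegral_const_mul _ hL]
        rw [lintegral_mul_const _ hL, ENNReal.rpow_two, sq]

lemma l2n_translate (g : V3 → ℝ≥0∞) (η : V3) : l2n (fun ξ => g (ξ - η)) = l2n g := by
  unfold l2n
  rw [lintegral_sub_right_eq_self (fun ξ => g ξ ^ (2 : ℝ)) η]

lemma l2n_reflect (g : V3 → ℝ≥0∞) (ξ : V3) : l2n (fun η => g (ξ - η)) = l2n g := by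
  unfold l2n
  rw [lintegral_sub_left_eq_self (fun ξ => g ξ ^ (2 : ℝ)) ξ]

/-- Convolution of `ℝ≥0∞`-valued functions. -/
def cv (f g : V3 → ℝ≥0∞) : V3 → ℝ≥0∞ := fun ξ => ∫⁻ η, f η * g (ξ - η)

lemma cv_comm (f g : V3 → ℝ≥0∞) : cv f g = cv g f := by
  funext ξ
  unfold cv
  rw [← lintegral_sub_left_eq_self (fun η => g η * f (ξ - η)) ξ]
  simp [mul_comm]

lemma measurable_cv {f g : V3 → ℝ≥0∞} (hf : Measurable f) (hg : Measurable g) :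
    Measurable (cv f g) :=
  Measurable.lintegral_prod_right' (f := fun p : V3 × V3 => f p.2 * g (p.1 - p.2)) (by fun_prop)

/-- Young's inequality `L¹ * L² ⊂ L²`. -/
lemma l2n_cv_le {f g : V3 → ℝ≥0∞} (hf : Measurable f) (hg : Measurable g) :
    l2n (cv f g) ≤ (∫⁻ η, f η) * l2n g := by
  unfold cv
  refine (l2n_lintegral_le (K := fun η ξ => f η * g (ξ - η)) ?_).trans ?_
  · simp only [Function.uncurry_def]; fun_prop
  · rw [← lintegral_mul_const _ hf]
    refine lintegral_mono fun η => ?_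
    rw [l2n_const_mul _ (by fun_prop), l2n_translate]

lemma lintegral_cv {f g : V3 → ℝ≥0∞} (hf : Measurable f) (hg : Measurable g) :
    ∫⁻ ξ, cv f g ξ = (∫⁻ η, f η) * ∫⁻ η, g η := by
  unfold cv
  rw [lintegral_lintegral_swap (by apply Measurable.aemeasurable; simp only [Function.uncurry_def]; fun_prop),
    ← lintegral_mul_const _ hf]
  refine lintegral_congr fun η => ?_
  rw [lintegral_const_mul _ (by fun_prop), lintegral_sub_right_eq_self g η]

lemma en_nonneg (ξ : V3) : 0 ≤ en ξ := Real.sqrt_nonneg _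

@[fun_prop]
lemma measurable_en : Measurable en := by unfold en; fun_prop

lemma en_eq_norm (ξ : V3) : en ξ = ‖WithLp.toLp 2 ξ‖ := by
  rw [EuclideanSpace.norm_eq]; simp [en]

lemma en_add_le (ξ η : V3) : en (ξ + η) ≤ en ξ + en η := by
  simp only [en_eq_norm, WithLp.toLp_add]; exact norm_add_le _ _

lemma en_neg (ξ : V3) : en (-ξ) = en ξ := by simp [en]

lemma en_le_add_sub (ξ η : V3) : en ξ ≤ en η + en (ξ - η) := by
  simpa using en_add_le η (ξ - η)

lemma en_sub_le (ξ η : V3) : en (ξ - η) ≤ en ξ + en η := by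
  simpa [sub_eq_add_neg, en_neg] using en_add_le ξ (-η)

lemma en_smul (c : ℝ) (hc : 0 ≤ c) (ξ : V3) : en (c • ξ) = c * en ξ := by
  simp only [en_eq_norm, WithLp.toLp_smul, norm_smul, Real.norm_of_nonneg hc]

lemma norm_le_en (ξ : V3) : ‖ξ‖ ≤ en ξ := by
  rw [pi_norm_le_iff_of_nonneg (en_nonneg ξ)]
  intro i
  exact Real.abs_le_sqrt (Finset.single_le_sum (f := fun i => ξ i ^ 2) (fun _ _ => sq_nonneg _)
    (Finset.mem_univ i))

lemma abs_apply_le_en (ξ : V3) (i : Fin 3) : |ξ i| ≤ en ξ :=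
  (norm_le_pi_norm ξ i).trans (norm_le_en ξ)

lemma en_eq_zero {ξ : V3} (h : en ξ = 0) : ξ = 0 := by
  have := norm_le_en ξ
  rw [h] at this
  exact norm_le_zero_iff.1 this

lemma lintegral_comp_smul_V3 (f : V3 → ℝ≥0∞) (hf : Measurable f) {c : ℝ} (hc : 0 < c) :
    ∫⁻ ξ, f ξ = ENNReal.ofReal (c ^ 3) * ∫⁻ ξ, f (c • ξ) := by
  have h1 : ∫⁻ ξ, f (c • ξ) = ∫⁻ ξ, f ξ ∂(Measure.map (fun x : V3 => c • x) volume) := by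
    rw [lintegral_map hf (measurable_const_smul c)]
  rw [h1, Measure.map_addHaar_smul volume hc.ne', lintegral_smul_measure, smul_eq_mul, ← mul_assoc,
    ← ENNReal.ofReal_mul (by positivity), abs_of_pos (by positivity)]
  simp [hc.ne']

/-- `x ^ p ≤ C e^{cx}`. -/
lemma exists_rpow_le_exp {p c : ℝ} (hp : 0 ≤ p) (hc : 0 < c) :
    ∃ C > (0 : ℝ), ∀ x : ℝ, 0 ≤ x → (1 + x) ^ p ≤ C * Real.exp (c * x) := by
  rcases hp.eq_or_lt with rfl | hp
  · exact ⟨1, one_pos, fun x hx => by simpa using by positivity⟩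
  · refine ⟨(1 + p / c) ^ p, by positivity, fun x hx => ?_⟩
    have h1 : 1 + x ≤ (1 + p / c) * Real.exp (c * x / p) := by
      have h2 := Real.add_one_le_exp (c * x / p)
      have h3 : (1 + p / c) * (c * x / p + 1) = x + 1 + c * x / p + p / c := by
        field_simp; ring
      have h4 : 0 ≤ c * x / p := by positivity
      have h5 : 0 ≤ p / c := by positivity
      calc 1 + x ≤ (1 + p / c) * (c * x / p + 1) := by rw [h3]; linarith
        _ ≤ _ := by gcongr
    calc (1 + x) ^ p ≤ ((1 + p / c) * Real.exp (c * x / p)) ^ p := by gcongr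
      _ = _ := by
        rw [Real.mul_rpow (by positivity) (by positivity), ← Real.exp_mul]
        field_simp

lemma exists_rpow_mul_exp_le {p c : ℝ} (hp : 0 ≤ p) (hc : 0 < c) :
    ∃ C > (0 : ℝ), ∀ u r : ℝ, 0 < u → 0 ≤ r →
      r ^ p * Real.exp (-(c * (u * r ^ 2))) ≤ C * u ^ (-(p / 2)) := by
  obtain ⟨C, hC, h⟩ := exists_rpow_le_exp (p := p / 2) (by positivity) hc
  refine ⟨C, hC, fun u r hu hr => ?_⟩
  have h1 := h (u * r ^ 2) (by positivity)
  have h2 : r ^ p = u ^ (-(p / 2)) * (u * r ^ 2) ^ (p / 2) := by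
    rw [Real.mul_rpow hu.le (by positivity), ← mul_assoc, ← Real.rpow_add hu, ← Real.rpow_natCast,
      ← Real.rpow_mul hr]
    norm_num
    congr 1; ring
  have h3 : (u * r ^ 2) ^ (p / 2) ≤ (1 + u * r ^ 2) ^ (p / 2) := by gcongr; linarith
  rw [Real.exp_neg, ← div_eq_mul_inv, div_le_iff₀ (by positivity), h2]
  calc _ ≤ u ^ (-(p / 2)) * (C * Real.exp (c * (u * r ^ 2))) := by gcongr; exact h3.trans h1
    _ = _ := by ring

/-- `e^{cx} x^{-κ}` is, up to a constant, increasing on `[1, ∞)`. -/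
lemma exists_exp_mul_rpow_le {κ c : ℝ} (hκ : 0 ≤ κ) (hc : 0 < c) :
    ∃ C > (0 : ℝ), ∀ x M : ℝ, 1 ≤ x → x ≤ M →
      Real.exp (c * x) * x ^ (-κ) ≤ C * (Real.exp (c * M) * M ^ (-κ)) := by
  obtain ⟨C, hC, h⟩ := exists_rpow_le_exp hκ hc
  refine ⟨C, hC, fun x M hx hM => ?_⟩
  have hx0 : 0 < x := by linarith
  have hM0 : 0 < M := by linarith
  have h1 : M / x ≤ 1 + (M - x) := by
    rw [div_le_iff₀ hx0]; nlinarith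
  have h2 : (M / x) ^ κ ≤ C * Real.exp (c * (M - x)) :=
    (Real.rpow_le_rpow (by positivity) h1 hκ).trans (h (M - x) (by linarith))
  have h3 : x ^ (-κ) = M ^ (-κ) * (M / x) ^ κ := by
    rw [Real.div_rpow hM0.le hx0.le, Real.rpow_neg hM0.le, Real.rpow_neg hx0.le]
    field_simp
  have h4 : Real.exp (c * M) = Real.exp (c * (M - x)) * Real.exp (c * x) := by
    rw [← Real.exp_add]; congr 1; ring
  rw [h3, h4]
  calc _ ≤ Real.exp (c * x) * (M ^ (-κ) * (C * Real.exp (c * (M - x)))) := by gcongr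
    _ = _ := by ring

lemma exists_lintegral_rpow_ball {p : ℝ} (hp : 0 ≤ p) (hp3 : p < 3) :
    ∃ C > (0 : ℝ), ∀ R : ℝ, 0 < R →
      ∫⁻ η : V3, (if en η ≤ R then ENNReal.ofReal (en η ^ (-p)) else 0)
        ≤ ENNReal.ofReal (C * R ^ (3 - p)) := by
  set I : ℝ≥0∞ := ∫⁻ η : V3, (if en η ≤ 1 then ENNReal.ofReal (en η ^ (-p)) else 0) with hI
  have hfin : I < ⊤ := by
    have h := integrableOn_ball_of_norm_le_rpow (E := V3) (μ := volume) (F := ℝ)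
      (f := fun x => ‖x‖ ^ (-p)) (C := 1) (α := p) (r := 2) (by simp) (by simpa using hp3)
      (by filter_upwards with x; rw [Real.norm_of_nonneg (by positivity), one_mul])
      (by apply Measurable.aestronglyMeasurable; fun_prop)
    have h2 := h.lintegral_lt_top
    refine lt_of_le_of_lt ?_ h2
    rw [← lintegral_indicator measurableSet_ball, hI]
    refine lintegral_mono fun η => ?_
    split_ifs with h1
    · have h4 : η ∈ Metric.ball (0 : V3) 2 := by
        simp only [mem_ball_zero_iff]; linarith [norm_le_en η]
      rw [indicator_of_mem h4]
      apply ENNReal.ofReal_le_ofReal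
      rcases eq_or_ne η 0 with rfl | h0
      · simp [en]
      · exact Real.rpow_le_rpow_of_nonpos (norm_pos_iff.2 h0) (norm_le_en η) (by linarith)
    · exact zero_le
  refine ⟨I.toReal + 1, by positivity, fun R hR => ?_⟩
  rw [lintegral_comp_smul_V3 _ (Measurable.ite (measurableSet_le (by fun_prop) (by fun_prop))
    (by fun_prop) (by fun_prop)) hR]
  have h5 : ∀ ξ : V3, (if en (R • ξ) ≤ R then ENNReal.ofReal (en (R • ξ) ^ (-p)) else 0)
      = ENNReal.ofReal (R ^ (-p)) * (if en ξ ≤ 1 then ENNReal.ofReal (en ξ ^ (-p)) else 0) := by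
    intro ξ
    rw [en_smul R hR.le, Real.mul_rpow hR.le (en_nonneg _), ENNReal.ofReal_mul (by positivity)]
    have : R * en ξ ≤ R ↔ en ξ ≤ 1 := by
      constructor <;> intro h <;> nlinarith
    simp [this]
  simp_rw [h5]
  rw [lintegral_const_mul _ (Measurable.ite (measurableSet_le (by fun_prop) (by fun_prop))
    (by fun_prop) (by fun_prop)), ← mul_assoc, ← ENNReal.ofReal_mul (by positivity),
    ← hI, ← ENNReal.ofReal_toReal hfin.ne, ← ENNReal.ofReal_mul (by positivity)]
  apply ENNReal.ofReal_le_ofReal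
  have h6 : R ^ (3 - p) = R ^ 3 * R ^ (-p) := by
    rw [← Real.rpow_natCast, ← Real.rpow_add hR]; norm_num [sub_eq_add_neg]
  rw [h6, ENNReal.toReal_ofReal (by positivity)]
  have : 0 < R ^ 3 * R ^ (-p) := by positivity
  nlinarith

lemma exists_lintegral_gaussian {q : ℝ} (hq : 0 ≤ q) :
    ∃ C > (0 : ℝ), ∀ u : ℝ, 0 < u →
      ∫⁻ ξ : V3, ENNReal.ofReal (en ξ ^ q * Real.exp (-(u * en ξ ^ 2)))
        ≤ ENNReal.ofReal (C * u ^ (-((q + 3) / 2))) := by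
  set I : ℝ≥0∞ := ∫⁻ ξ : V3, ENNReal.ofReal (en ξ ^ q * Real.exp (-(en ξ ^ 2))) with hI
  have hfin : I < ⊤ := by
    obtain ⟨C, hC, h⟩ := exists_rpow_le_exp (p := q + 4) (by linarith) one_pos
    have h2 := finite_integral_one_add_norm (E := V3) (μ := volume) (r := 4) (by simp; norm_num)
    have h3 : I ≤ ENNReal.ofReal (C * Real.exp 1) *
        ∫⁻ x : V3, ENNReal.ofReal ((1 + ‖x‖) ^ (-(4 : ℝ))) := by
      rw [← lintegral_const_mul _ (by fun_prop)]
      refine lintegral_mono fun ξ => ?_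
      rw [← ENNReal.ofReal_mul (by positivity)]
      apply ENNReal.ofReal_le_ofReal
      have h4 := h (en ξ) (en_nonneg ξ)
      have h0 := en_nonneg ξ
      rw [Real.rpow_add (by positivity)] at h4
      have h5 : (1 + en ξ) ^ (-(4 : ℝ)) ≤ (1 + ‖ξ‖) ^ (-(4 : ℝ)) :=
        Real.rpow_le_rpow_of_nonpos (by positivity) (by linarith [norm_le_en ξ]) (by norm_num)
      have h6 : en ξ ^ q ≤ (1 + en ξ) ^ q := by gcongr; linarith
      have h7 : Real.exp (1 * en ξ) * Real.exp (-(en ξ ^ 2)) ≤ Real.exp 1 := by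
        rw [← Real.exp_add]; apply Real.exp_le_exp.2; nlinarith [sq_nonneg (en ξ - 1)]
      have h8 : (1 + en ξ) ^ q ≤ C * Real.exp (1 * en ξ) * (1 + en ξ) ^ (-(4 : ℝ)) := by
        rw [Real.rpow_neg (by positivity), ← div_eq_mul_inv, le_div_iff₀ (by positivity)]
        exact h4
      calc _ ≤ C * Real.exp (1 * en ξ) * (1 + en ξ) ^ (-(4 : ℝ)) * Real.exp (-(en ξ ^ 2)) := by
            gcongr; exact h6.trans h8
        _ = C * (Real.exp (1 * en ξ) * Real.exp (-(en ξ ^ 2))) * (1 + en ξ) ^ (-(4 : ℝ)) := by ring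
        _ ≤ _ := by gcongr
    exact lt_of_le_of_lt h3 (ENNReal.mul_lt_top ENNReal.ofReal_lt_top h2)
  refine ⟨I.toReal + 1, by positivity, fun u hu => ?_⟩
  have hc : 0 < u ^ (-(1 / 2 : ℝ)) := by positivity
  rw [lintegral_comp_smul_V3 _ (by fun_prop) hc]
  have h5 : ∀ ξ : V3, ENNReal.ofReal (en (u ^ (-(1 / 2 : ℝ)) • ξ) ^ q *
        Real.exp (-(u * en (u ^ (-(1 / 2 : ℝ)) • ξ) ^ 2)))
      = ENNReal.ofReal ((u ^ (-(1 / 2 : ℝ))) ^ q) *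
        ENNReal.ofReal (en ξ ^ q * Real.exp (-(en ξ ^ 2))) := by
    intro ξ
    have : u * (u ^ (-(1 / 2 : ℝ)) * en ξ) ^ 2 = en ξ ^ 2 := by
      have h7 : u * (u ^ (-(1 / 2 : ℝ))) ^ 2 = 1 := by
        rw [← Real.rpow_natCast, ← Real.rpow_mul hu.le]
        norm_num [Real.rpow_neg hu.le, hu.ne']
      rw [mul_pow, ← mul_assoc, h7, one_mul]
    rw [en_smul _ hc.le, this, Real.mul_rpow hc.le (en_nonneg _),
      ← ENNReal.ofReal_mul (by positivity), mul_assoc]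
  simp_rw [h5]
  rw [lintegral_const_mul _ (by fun_prop), ← mul_assoc, ← ENNReal.ofReal_mul (by positivity),
    ← hI, ← ENNReal.ofReal_toReal hfin.ne, ← ENNReal.ofReal_mul (by positivity)]
  apply ENNReal.ofReal_le_ofReal
  have h6 : u ^ (-((q + 3) / 2)) = (u ^ (-(1 / 2 : ℝ))) ^ 3 * (u ^ (-(1 / 2 : ℝ))) ^ q := by
    rw [← Real.rpow_natCast, ← Real.rpow_mul hu.le, ← Real.rpow_mul hu.le, ← Real.rpow_add hu]
    congr 1; push_cast; ring
  rw [h6, ENNReal.toReal_ofReal (by positivity)]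
  have : 0 < (u ^ (-(1 / 2 : ℝ))) ^ 3 * (u ^ (-(1 / 2 : ℝ))) ^ q := by positivity
  nlinarith

lemma setLIntegral_Ioo_reflect (k : ℝ → ℝ≥0∞) (t : ℝ) :
    ∫⁻ s in Ioo 0 t, k (t - s) = ∫⁻ s in Ioo 0 t, k s := by
  rw [← lintegral_indicator measurableSet_Ioo, ← lintegral_indicator measurableSet_Ioo,
    ← lintegral_sub_left_eq_self _ t]
  refine lintegral_congr fun s => ?_
  have : t - s ∈ Ioo 0 t ↔ s ∈ Ioo 0 t := by
    simp only [mem_Ioo]; constructor <;> rintro ⟨h1, h2⟩ <;> constructor <;> linarith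
  by_cases h : s ∈ Ioo 0 t
  · rw [indicator_of_mem h, indicator_of_mem (this.2 h)]; simp
  · rw [indicator_of_notMem h, indicator_of_notMem (fun h' => h (this.1 h'))]

lemma setLIntegral_Ioo_rpow {p t : ℝ} (hp : p < 1) (ht : 0 < t) :
    ∫⁻ s in Ioo 0 t, ENNReal.ofReal (s ^ (-p)) = ENNReal.ofReal (t ^ (1 - p) / (1 - p)) := by
  have hi := intervalIntegral.intervalIntegrable_rpow' (a := 0) (b := t) (r := -p) (by linarith)
  rw [intervalIntegrable_iff_integrableOn_Ioo_of_le ht.le] at hi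
  rw [← ofReal_integral_eq_lintegral_ofReal hi, ← integral_Ioc_eq_integral_Ioo,
    ← intervalIntegral.integral_of_le ht.le, integral_rpow (Or.inl (by linarith)),
    Real.zero_rpow (by linarith)]
  · congr 2 <;> ring_nf
  · filter_upwards [ae_restrict_mem measurableSet_Ioo] with s hs
    exact Real.rpow_nonneg hs.1.le _

lemma rpow_neg_anti {x y p : ℝ} (hx : 0 < x) (hxy : x ≤ y) (hp : 0 ≤ p) : y ^ (-p) ≤ x ^ (-p) :=
  Real.rpow_le_rpow_of_nonpos hx hxy (by linarith)

/-- Convolution-type time integrals on `(0,t)`, split at the midpoint. -/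
lemma setLIntegral_Ioo_conv_le {k l : ℝ → ℝ} {t : ℝ} (ht : 0 < t) (hk : Measurable k)
    (hl : Measurable l) (hk0 : ∀ s, 0 < s → 0 ≤ k s) (hl0 : ∀ s, 0 < s → 0 ≤ l s)
    (hka : ∀ s, t / 2 ≤ s → k s ≤ k (t / 2)) (hla : ∀ s, t / 2 ≤ s → l s ≤ l (t / 2)) :
    ∫⁻ s in Ioo 0 t, ENNReal.ofReal (k s * l (t - s))
      ≤ ENNReal.ofReal (k (t / 2)) * (∫⁻ s in Ioo 0 t, ENNReal.ofReal (l s)) +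
        ENNReal.ofReal (l (t / 2)) * ∫⁻ s in Ioo 0 t, ENNReal.ofReal (k s) := by
  rw [← setLIntegral_Ioo_reflect (fun s => ENNReal.ofReal (l s)),
    ← lintegral_const_mul _ (by fun_prop), ← lintegral_const_mul _ (by fun_prop),
    ← lintegral_add_left (by fun_prop)]
  refine setLIntegral_mono (by fun_prop) fun s hs => ?_
  have h1 := hk0 s hs.1
  have h2 := hl0 (t - s) (by linarith [hs.2])
  have h3 := hk0 (t / 2) (by linarith)
  have h4 := hl0 (t / 2) (by linarith)
  rw [← ENNReal.ofReal_mul h3, ← ENNReal.ofReal_mul h4, ← ENNReal.ofReal_add (by positivity)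
    (by positivity)]
  apply ENNReal.ofReal_le_ofReal
  rcases le_total (t / 2) s with h | h
  · have := mul_le_mul_of_nonneg_right (hka s h) h2
    have : 0 ≤ l (t / 2) * k s := by positivity
    linarith
  · have := mul_le_mul_of_nonneg_left (hla (t - s) (by linarith)) h1
    have : 0 ≤ k (t / 2) * l (t - s) := by positivity
    linarith

lemma exists_beta {p q : ℝ} (hp0 : 0 ≤ p) (hp : p < 1) (hq0 : 0 ≤ q) (hq : q < 1) :
    ∃ C > (0 : ℝ), ∀ t : ℝ, 0 < t →
      ∫⁻ s in Ioo 0 t, ENNReal.ofReal (s ^ (-p) * (t - s) ^ (-q))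
        ≤ ENNReal.ofReal (C * t ^ (1 - p - q)) := by
  have hp' : 0 < 1 - p := by linarith
  have hq' : 0 < 1 - q := by linarith
  refine ⟨2 ^ p * (1 - q)⁻¹ + 2 ^ q * (1 - p)⁻¹, by positivity, fun t ht => ?_⟩
  refine (setLIntegral_Ioo_conv_le (k := fun s => s ^ (-p)) (l := fun s => s ^ (-q)) ht
    (by fun_prop) (by fun_prop) (fun s hs => by positivity) (fun s hs => by positivity)
    (fun s hs => rpow_neg_anti (by linarith) hs hp0)
    (fun s hs => rpow_neg_anti (by linarith) hs hq0)).trans ?_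
  rw [setLIntegral_Ioo_rpow hp ht, setLIntegral_Ioo_rpow hq ht, ← ENNReal.ofReal_mul (by positivity),
    ← ENNReal.ofReal_mul (by positivity), ← ENNReal.ofReal_add (by positivity) (by positivity)]
  apply ENNReal.ofReal_le_ofReal
  apply le_of_eq
  rw [Real.div_rpow ht.le zero_le_two, Real.div_rpow ht.le zero_le_two, Real.rpow_neg zero_le_two,
    Real.rpow_neg zero_le_two]
  have h1 : t ^ (1 - p - q) = t ^ (-p) * t ^ (1 - q) := by
    rw [← Real.rpow_add ht]; congr 1; ring
  have h2 : t ^ (-q) * t ^ (1 - p) = t ^ (-p) * t ^ (1 - q) := by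
    rw [← Real.rpow_add ht, ← Real.rpow_add ht]; congr 1; ring
  rw [h1]
  have h3 : t ^ (-q) / (2 ^ q)⁻¹ * (t ^ (1 - p) / (1 - p))
    = 2 ^ q * (1 - p)⁻¹ * (t ^ (-q) * t ^ (1 - p)) := by field_simp
  rw [h3, h2]
  field_simp

lemma exists_time_kernel_large {δ c : ℝ} (hδ : 0 < δ) (hδ1 : δ < 1) (hc : 0 < c) :
    ∃ C > (0 : ℝ), ∀ t N : ℝ, 0 < t → 0 < N →
      ∫⁻ s in Ioo 0 t, ENNReal.ofReal
          (s ^ (-δ) * ((t - s) ^ (-(1 - δ / 2)) * Real.exp (-(c * (N ^ 2 * (t - s))))))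
        ≤ ENNReal.ofReal (C * (t ^ (-(δ / 2)) * (N ^ 2 * t) ^ (-(δ / 2)))) := by
  have hδ' : 0 < 1 - δ := by linarith
  obtain ⟨D, hD, hexp⟩ := exists_rpow_le_exp (p := δ / 2) (c := c / 2) (by positivity) (by positivity)
  refine ⟨2 ^ δ * (c⁻¹ ^ (δ / 2) * Real.Gamma (δ / 2)) + 2 ^ (1 - δ / 2) * (1 - δ)⁻¹ * D, ?_,
    fun t N ht hN => ?_⟩
  · have := Real.Gamma_pos_of_pos (show 0 < δ / 2 by positivity)
    positivity
  have hg : ∫⁻ s in Ioo 0 t, ENNReal.ofReal (s ^ (-(1 - δ / 2)) * Real.exp (-(c * (N ^ 2 * s))))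
      ≤ ENNReal.ofReal ((1 / (c * N ^ 2)) ^ (δ / 2) * Real.Gamma (δ / 2)) := by
    rw [← Real.integral_rpow_mul_exp_neg_mul_Ioi (by positivity) (by positivity),
      ofReal_integral_eq_lintegral_ofReal]
    · refine (lintegral_mono_set Ioo_subset_Ioi_self).trans (le_of_eq ?_)
      refine lintegral_congr fun s => ?_
      congr 3 <;> ring_nf
    · have h := integrableOn_rpow_mul_exp_neg_mul_rpow (s := δ / 2 - 1) (p := 1) (b := c * N ^ 2)
        (by linarith) one_pos (by positivity)
      simp only [Real.rpow_one, neg_mul] at h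
      exact h
    · filter_upwards [ae_restrict_mem measurableSet_Ioi] with s hs
      have : (0 : ℝ) < s := hs
      positivity
  refine (setLIntegral_Ioo_conv_le (k := fun s => s ^ (-δ))
    (l := fun s => s ^ (-(1 - δ / 2)) * Real.exp (-(c * (N ^ 2 * s)))) ht
    (by fun_prop) (by fun_prop) (fun s hs => by positivity) (fun s hs => by positivity)
    (fun s hs => rpow_neg_anti (by linarith) hs hδ.le)
    (fun s hs => ?_)).trans ?_
  · have : 0 < s := by linarith
    have := rpow_neg_anti (p := 1 - δ / 2) (show 0 < t / 2 by linarith) hs (by linarith)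
    gcongr
  refine (add_le_add (mul_le_mul_right hg _) le_rfl).trans ?_
  have hG := (Real.Gamma_pos_of_pos (show 0 < δ / 2 by positivity)).le
  rw [setLIntegral_Ioo_rpow hδ1 ht, ← ENNReal.ofReal_mul (by positivity),
    ← ENNReal.ofReal_mul (by positivity),
    ← ENNReal.ofReal_add (by positivity) (by positivity)]
  apply ENNReal.ofReal_le_ofReal
  set y := N ^ 2 * t with hy
  have hy0 : 0 < y := by positivity
  have h1 : (t / 2) ^ (-δ) * ((1 / (c * N ^ 2)) ^ (δ / 2) * Real.Gamma (δ / 2))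
      = 2 ^ δ * (c⁻¹ ^ (δ / 2) * Real.Gamma (δ / 2)) * (t ^ (-(δ / 2)) * y ^ (-(δ / 2))) := by
    have e1 : (1 / (c * N ^ 2)) ^ (δ / 2) = c⁻¹ ^ (δ / 2) * (t ^ (δ / 2) * y ^ (-(δ / 2))) := by
      rw [Real.rpow_neg hy0.le, ← Real.inv_rpow hy0.le, ← Real.mul_rpow ht.le (by positivity),
        ← Real.mul_rpow (by positivity) (by positivity)]
      congr 1
      rw [hy]; field_simp
    have e2 : t ^ (-δ) * t ^ (δ / 2) = t ^ (-(δ / 2)) := by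
      rw [← Real.rpow_add ht]; congr 1; ring
    rw [e1, ← e2, Real.div_rpow ht.le zero_le_two, Real.rpow_neg zero_le_two]
    field_simp
  have h2 : (t / 2) ^ (-(1 - δ / 2)) * Real.exp (-(c * (N ^ 2 * (t / 2)))) * (t ^ (1 - δ) / (1 - δ))
      ≤ 2 ^ (1 - δ / 2) * (1 - δ)⁻¹ * D * (t ^ (-(δ / 2)) * y ^ (-(δ / 2))) := by
    have e1 : Real.exp (-(c * (N ^ 2 * (t / 2)))) ≤ D * y ^ (-(δ / 2)) := by
      have h3 := hexp y hy0.le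
      have h4 : y ^ (δ / 2) ≤ (1 + y) ^ (δ / 2) := by gcongr; linarith
      rw [Real.exp_neg, Real.rpow_neg hy0.le, ← div_eq_mul_inv, inv_eq_one_div,
        div_le_div_iff₀ (by positivity) (by positivity), one_mul]
      have h5 : c * (N ^ 2 * (t / 2)) = c / 2 * y := by rw [hy]; ring
      rw [h5]; exact h4.trans h3
    have e2 : t ^ (-(1 - δ / 2)) * t ^ (1 - δ) = t ^ (-(δ / 2)) := by
      rw [← Real.rpow_add ht]; congr 1; ring
    calc _ ≤ (t / 2) ^ (-(1 - δ / 2)) * (D * y ^ (-(δ / 2))) * (t ^ (1 - δ) / (1 - δ)) := by gcongr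
      _ = _ := by
        rw [← e2, Real.div_rpow ht.le zero_le_two, Real.rpow_neg zero_le_two]
        field_simp
  linarith

/-- Time integral arising from the interaction of two high-frequency parts. -/
lemma exists_time_high_high {δ c : ℝ} (hδ : 0 < δ) (hδ1 : δ < 1) (hc : 0 < c) :
    ∃ C > (0 : ℝ), ∀ t T N lam : ℝ, 0 < t → t ≤ T → 0 < N → 1 ≤ lam → N ^ 2 * T = lam ^ 2 →
      ∫⁻ s in Ioo 0 t, ENNReal.ofReal (t ^ (δ / 2) * s ^ (-δ) * (t - s) ^ (-(1 - δ / 2)) *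
          Real.exp (-(c * (N ^ 2 * (t - s)))) * Real.exp (N ^ 2 * t / 4))
        ≤ ENNReal.ofReal (C * (lam ^ (-δ) * Real.exp (lam ^ 2 / 4))) := by
  obtain ⟨C1, hC1, h1⟩ := exists_time_kernel_large hδ hδ1 hc
  obtain ⟨C2, hC2, h2⟩ := exists_beta (p := δ) (q := 1 - δ / 2) hδ.le hδ1 (by linarith) (by linarith)
  obtain ⟨C3, hC3, h3⟩ := exists_exp_mul_rpow_le (κ := δ / 2) (c := 1 / 4) (by positivity) (by norm_num)
  refine ⟨(C1 + C2) * C3, by positivity, fun t T N lam ht htT hN hlam hNT => ?_⟩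
  have hl0 : 0 < lam := by linarith
  have hM : (lam ^ 2) ^ (-(δ / 2)) = lam ^ (-δ) := by
    rw [← Real.rpow_natCast, ← Real.rpow_mul hl0.le]; congr 1; push_cast; ring
  have hle : N ^ 2 * t ≤ lam ^ 2 := by rw [← hNT]; gcongr
  have hsplit : ∀ s, ENNReal.ofReal (t ^ (δ / 2) * s ^ (-δ) * (t - s) ^ (-(1 - δ / 2)) *
          Real.exp (-(c * (N ^ 2 * (t - s)))) * Real.exp (N ^ 2 * t / 4))
      = ENNReal.ofReal (t ^ (δ / 2) * Real.exp (N ^ 2 * t / 4)) * ENNReal.ofReal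
          (s ^ (-δ) * ((t - s) ^ (-(1 - δ / 2)) * Real.exp (-(c * (N ^ 2 * (t - s)))))) := by
    intro s
    rw [← ENNReal.ofReal_mul (by positivity)]; congr 1; ring
  simp_rw [hsplit]
  rw [lintegral_const_mul _ (by fun_prop)]
  have htt : t ^ (δ / 2) * t ^ (-(δ / 2)) = 1 := by
    rw [← Real.rpow_add ht]; simp
  have hlast : 0 < lam ^ (-δ) * Real.exp (lam ^ 2 / 4) := by positivity
  rcases le_total 1 (N ^ 2 * t) with hy | hy
  · refine (mul_le_mul_right (h1 t N ht hN) _).trans ?_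
    rw [← ENNReal.ofReal_mul (by positivity)]
    apply ENNReal.ofReal_le_ofReal
    have h4 := h3 (N ^ 2 * t) (lam ^ 2) hy hle
    rw [hM] at h4
    calc _ = C1 * (t ^ (δ / 2) * t ^ (-(δ / 2))) *
          (Real.exp (1 / 4 * (N ^ 2 * t)) * (N ^ 2 * t) ^ (-(δ / 2))) := by
          rw [show N ^ 2 * t / 4 = 1 / 4 * (N ^ 2 * t) by ring]; ring
      _ ≤ C1 * 1 * (C3 * (Real.exp (1 / 4 * lam ^ 2) * lam ^ (-δ))) := by rw [htt]; gcongr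
      _ = C1 * C3 * (lam ^ (-δ) * Real.exp (lam ^ 2 / 4)) := by
          rw [show 1 / 4 * lam ^ 2 = lam ^ 2 / 4 by ring]; ring
      _ ≤ _ := by gcongr; linarith
  · have h5 : ∫⁻ s in Ioo 0 t, ENNReal.ofReal
          (s ^ (-δ) * ((t - s) ^ (-(1 - δ / 2)) * Real.exp (-(c * (N ^ 2 * (t - s))))))
        ≤ ENNReal.ofReal (C2 * t ^ (1 - δ - (1 - δ / 2))) := by
      refine le_trans ?_ (h2 t ht)
      refine setLIntegral_mono (by fun_prop) fun s hs => ?_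
      apply ENNReal.ofReal_le_ofReal
      have hs1 := hs.1
      have hs2 : 0 < t - s := by linarith [hs.2]
      have : Real.exp (-(c * (N ^ 2 * (t - s)))) ≤ 1 := by
        apply Real.exp_le_one_iff.2
        have : 0 < c * (N ^ 2 * (t - s)) := by positivity
        linarith
      have h6 : 0 < (t - s) ^ (-(1 - δ / 2)) := by positivity
      gcongr
      nlinarith
    refine (mul_le_mul_right h5 _).trans ?_
    rw [← ENNReal.ofReal_mul (by positivity)]
    apply ENNReal.ofReal_le_ofReal
    have h4 := h3 1 (lam ^ 2) le_rfl (by nlinarith)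
    rw [hM, Real.one_rpow, mul_one] at h4
    have e1 : (1 - δ - (1 - δ / 2)) = -(δ / 2) := by ring
    rw [e1]
    calc _ = C2 * (t ^ (δ / 2) * t ^ (-(δ / 2))) * Real.exp (1 / 4 * (N ^ 2 * t)) := by
          rw [show N ^ 2 * t / 4 = 1 / 4 * (N ^ 2 * t) by ring]; ring
      _ ≤ C2 * 1 * Real.exp (1 / 4 * 1) := by rw [htt]; gcongr
      _ ≤ C2 * 1 * (C3 * (Real.exp (1 / 4 * lam ^ 2) * lam ^ (-δ))) := by gcongr
      _ = C2 * C3 * (lam ^ (-δ) * Real.exp (lam ^ 2 / 4)) := by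
          rw [show 1 / 4 * lam ^ 2 = lam ^ 2 / 4 by ring]; ring
      _ ≤ _ := by gcongr; linarith

/-- Time integral arising from the interaction of a low- and a high-frequency part. -/
lemma exists_time_low_high {δ : ℝ} (hδ : 0 < δ) (hδ1 : δ < 1) :
    ∃ C > (0 : ℝ), ∀ t T N : ℝ, 0 < t → t ≤ T → 0 < N → 1 ≤ N ^ 2 * T →
      ∫⁻ s in Ioo 0 t, ENNReal.ofReal (t ^ (δ / 2) * s ^ (-(δ / 2)) *
          (N + (t - s) ^ (-(1 / 2 : ℝ))))
        ≤ ENNReal.ofReal (C * (N * T)) := by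
  obtain ⟨C1, hC1, h1⟩ := exists_beta (p := δ / 2) (q := 0) (by positivity) (by linarith) le_rfl
    (by norm_num)
  obtain ⟨C2, hC2, h2⟩ := exists_beta (p := δ / 2) (q := 1 / 2) (by positivity) (by linarith)
    (by norm_num) (by norm_num)
  refine ⟨C1 + C2, by positivity, fun t T N ht htT hN hNT => ?_⟩
  have hT : 0 < T := by linarith
  have hsplit : ∀ s ∈ Ioo 0 t, ENNReal.ofReal (t ^ (δ / 2) * s ^ (-(δ / 2)) *
          (N + (t - s) ^ (-(1 / 2 : ℝ))))
      = ENNReal.ofReal (t ^ (δ / 2) * N) * ENNReal.ofReal (s ^ (-(δ / 2)) * (t - s) ^ (-(0 : ℝ))) +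
        ENNReal.ofReal (t ^ (δ / 2)) * ENNReal.ofReal (s ^ (-(δ / 2)) * (t - s) ^ (-(1 / 2 : ℝ))) := by
    intro s hs
    have h3 := hs.1
    have h4 : 0 < t - s := by linarith [hs.2]
    rw [← ENNReal.ofReal_mul (by positivity), ← ENNReal.ofReal_mul (by positivity),
      ← ENNReal.ofReal_add (by positivity) (by positivity)]
    congr 1
    simp only [neg_zero, Real.rpow_zero]; ring
  rw [setLIntegral_congr_fun measurableSet_Ioo hsplit, lintegral_add_left (by fun_prop),
    lintegral_const_mul _ (by fun_prop), lintegral_const_mul _ (by fun_prop)]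
  refine (add_le_add (mul_le_mul_right (h1 t ht) _) (mul_le_mul_right (h2 t ht) _)).trans ?_
  rw [← ENNReal.ofReal_mul (by positivity), ← ENNReal.ofReal_mul (by positivity),
      ← ENNReal.ofReal_add (by positivity) (by positivity)]
  apply ENNReal.ofReal_le_ofReal
  have e1 : t ^ (δ / 2) * t ^ (1 - δ / 2 - 0) = t := by
    rw [← Real.rpow_add ht]; ring_nf; exact Real.rpow_one t
  have e2 : t ^ (δ / 2) * t ^ (1 - δ / 2 - 1 / 2) = Real.sqrt t := by
    rw [← Real.rpow_add ht, Real.sqrt_eq_rpow]; congr 1; ring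
  have e3 : Real.sqrt t ≤ N * T := by
    apply Real.sqrt_le_iff.2 ⟨by positivity, ?_⟩
    calc t ≤ T * 1 := by linarith
      _ ≤ T * (N ^ 2 * T) := by gcongr
      _ = _ := by ring
  calc _ = C1 * (N * (t ^ (δ / 2) * t ^ (1 - δ / 2 - 0))) +
        C2 * (t ^ (δ / 2) * t ^ (1 - δ / 2 - 1 / 2)) := by ring
    _ ≤ C1 * (N * T) + C2 * (N * T) := by rw [e1, e2]; gcongr
    _ = _ := by ring

lemma ofReal_rpow_two {x : ℝ} (hx : 0 ≤ x) : ENNReal.ofReal x ^ (2 : ℝ) = ENNReal.ofReal (x ^ 2) := by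
  rw [ENNReal.ofReal_rpow_of_nonneg hx (by norm_num)]; norm_num

lemma l2n_le_ofReal {h : V3 → ℝ≥0∞} {B : ℝ} (hB : 0 ≤ B)
    (hh : ∫⁻ ξ, h ξ ^ (2 : ℝ) ≤ ENNReal.ofReal (B ^ 2)) : l2n h ≤ ENNReal.ofReal B := by
  apply le_of_rpow_two_le
  rwa [l2n_rpow_two, ofReal_rpow_two hB]

lemma exists_l2n_rpow_ball {p : ℝ} (hp : 0 ≤ p) (hp3 : 2 * p < 3) :
    ∃ C > (0 : ℝ), ∀ R : ℝ, 0 < R →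
      l2n (fun η => if en η ≤ R then ENNReal.ofReal (en η ^ (-p)) else 0)
        ≤ ENNReal.ofReal (C * R ^ (3 / 2 - p)) := by
  obtain ⟨C, hC, h⟩ := exists_lintegral_rpow_ball (p := 2 * p) (by positivity) hp3
  refine ⟨Real.sqrt C, by positivity, fun R hR => l2n_le_ofReal (by positivity) ?_⟩
  have e1 : (Real.sqrt C * R ^ (3 / 2 - p)) ^ 2 = C * R ^ (3 - 2 * p) := by
    rw [mul_pow, Real.sq_sqrt hC.le, ← Real.rpow_natCast, ← Real.rpow_mul hR.le]
    congr 2; push_cast; ring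
  rw [e1]
  refine le_trans (lintegral_mono fun η => ?_) (h R hR)
  split_ifs with hη
  · have h0 := en_nonneg η
    rw [ofReal_rpow_two (by positivity), ← Real.rpow_natCast, ← Real.rpow_mul h0]
    apply le_of_eq; congr 2; push_cast; ring
  · simp

lemma exists_l2n_gaussian {q : ℝ} (hq : 0 ≤ q) :
    ∃ C > (0 : ℝ), ∀ u : ℝ, 0 < u →
      l2n (fun ξ => ENNReal.ofReal (en ξ ^ q * Real.exp (-(u * en ξ ^ 2 / 4))))
        ≤ ENNReal.ofReal (C * u ^ (-((2 * q + 3) / 4))) := by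
  obtain ⟨C, hC, h⟩ := exists_lintegral_gaussian (q := 2 * q) (by positivity)
  refine ⟨Real.sqrt (C * 2 ^ ((2 * q + 3) / 2)), by positivity,
    fun u hu => l2n_le_ofReal (by positivity) ?_⟩
  have e1 : (Real.sqrt (C * 2 ^ ((2 * q + 3) / 2)) * u ^ (-((2 * q + 3) / 4))) ^ 2
      = C * (u / 2) ^ (-((2 * q + 3) / 2)) := by
    rw [mul_pow, Real.sq_sqrt (by positivity), ← Real.rpow_natCast, ← Real.rpow_mul hu.le,
      Real.div_rpow hu.le zero_le_two, Real.rpow_neg zero_le_two, mul_assoc, div_inv_eq_mul,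
      mul_comm (u ^ _)]
    congr 3; push_cast; ring
  rw [e1]
  refine le_trans (lintegral_mono fun η => ?_) (h (u / 2) (by positivity))
  have h0 := en_nonneg η
  rw [ofReal_rpow_two (by positivity), mul_pow, ← Real.rpow_natCast (en η ^ q), ← Real.rpow_mul h0,
    ← Real.exp_nat_mul]
  apply le_of_eq; congr 3 <;> push_cast <;> ring

lemma two_rpow_add_le {x y : ℝ≥0∞} : x * y ≤ x ^ (2 : ℝ) + y ^ (2 : ℝ) := by
  rw [ENNReal.rpow_two, ENNReal.rpow_two, sq, sq]
  rcases le_total x y with h | h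
  · exact (mul_le_mul_left h y).trans le_add_self
  · exact (mul_le_mul_right h x).trans le_self_add

/-- Pointwise bound for the convolution of two functions in the homogeneous space with weight
`|ξ|^a`. -/
lemma exists_cv_weighted_le {a : ℝ} (ha : 0 < a) (ha3 : 4 * a < 3) :
    ∃ C > (0 : ℝ), ∀ φ ψ : V3 → ℝ≥0∞, Measurable φ → Measurable ψ → ∀ ξ : V3, 0 < en ξ →
      cv (fun η => ENNReal.ofReal (en η ^ (-a)) * φ η) (fun η => ENNReal.ofReal (en η ^ (-a)) * ψ η) ξ
        ≤ ENNReal.ofReal (C * en ξ ^ (3 / 2 - 2 * a)) *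
            (cv (fun η => φ η ^ (2 : ℝ)) (fun η => ψ η ^ (2 : ℝ)) ξ) ^ ((1 : ℝ) / 2)
          + ENNReal.ofReal (en ξ ^ (-(2 * a))) * (l2n φ * l2n ψ) := by
  obtain ⟨C, hC, hball⟩ := exists_lintegral_rpow_ball (p := 4 * a) (by positivity) ha3
  refine ⟨Real.sqrt (2 * C * 3 ^ (3 - 4 * a)), by positivity, fun φ ψ hφ hψ ξ hξ => ?_⟩
  set r := en ξ with hr
  have hψr : Measurable (fun η => ψ (ξ - η)) := by fun_prop
  set w : V3 → ℝ≥0∞ := fun η => ENNReal.ofReal (en η ^ (-a)) with hw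
  have hwm : Measurable w := by fun_prop
  have hwmr : Measurable (fun η => w (ξ - η)) := by fun_prop
  set Q : V3 → ℝ≥0∞ := fun η => if en η ≤ 2 * r then w η * w (ξ - η) else 0 with hQ
  have hset : MeasurableSet {η : V3 | en η ≤ 2 * r} := measurableSet_le (by fun_prop) (by fun_prop)
  have hQm : Measurable Q := Measurable.ite hset (by fun_prop) (by fun_prop)
  have hpt : ∀ η, w η * φ η * (w (ξ - η) * ψ (ξ - η)) ≤
      (φ η * ψ (ξ - η)) * Q η + ENNReal.ofReal (r ^ (-(2 * a))) * (φ η * ψ (ξ - η)) := by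
    intro η
    by_cases h : en η ≤ 2 * r
    · refine le_trans (le_of_eq ?_) le_self_add
      simp only [hQ, h, if_true]; ring
    · refine le_trans ?_ le_add_self
      have h1 : r ≤ en η := by linarith
      have h2 : r ≤ en (ξ - η) := by
        have := en_sub_le ξ (ξ - η)
        rw [sub_sub_cancel] at this; linarith
      have h3 : w η * w (ξ - η) ≤ ENNReal.ofReal (r ^ (-(2 * a))) := by
        simp only [hw]
        rw [← ENNReal.ofReal_mul (by have := en_nonneg η; positivity)]
        apply ENNReal.ofReal_le_ofReal
        rw [show -(2 * a) = -a + -a by ring, Real.rpow_add hξ]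
        have := en_nonneg (ξ - η)
        have := rpow_neg_anti hξ h1 ha.le
        have := rpow_neg_anti hξ h2 ha.le
        gcongr
      calc _ = w η * w (ξ - η) * (φ η * ψ (ξ - η)) := by ring
        _ ≤ _ := by gcongr
  have hQ2 : l2n Q ≤ ENNReal.ofReal (Real.sqrt (2 * C * 3 ^ (3 - 4 * a)) * r ^ (3 / 2 - 2 * a)) := by
    apply l2n_le_ofReal (by positivity)
    set B : V3 → ℝ≥0∞ := fun η => if en η ≤ 3 * r then ENNReal.ofReal (en η ^ (-(4 * a))) else 0
      with hB
    have hBm : Measurable B := Measurable.ite (measurableSet_le (by fun_prop) (by fun_prop))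
      (by fun_prop) (by fun_prop)
    have hw4 : ∀ η, (w η ^ (2 : ℝ)) ^ (2 : ℝ) = ENNReal.ofReal (en η ^ (-(4 * a))) := by
      intro η
      have := en_nonneg η
      rw [ofReal_rpow_two (by positivity), ofReal_rpow_two (by positivity), ← pow_mul,
        ← Real.rpow_natCast, ← Real.rpow_mul this]
      congr 2; push_cast; ring
    have hQB : ∀ η, Q η ^ (2 : ℝ) ≤ B η + B (ξ - η) := by
      intro η
      by_cases h : en η ≤ 2 * r
      · have h1 : en η ≤ 3 * r := by linarith
        have h2 : en (ξ - η) ≤ 3 * r := by linarith [en_sub_le ξ η]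
        simp only [hQ, hB, h, h1, h2, if_true]
        rw [ENNReal.mul_rpow_of_nonneg _ _ zero_le_two, ← hw4, ← hw4]
        exact two_rpow_add_le
      · simp [hQ, h]
    calc ∫⁻ η, Q η ^ (2 : ℝ) ≤ ∫⁻ η, (B η + B (ξ - η)) := lintegral_mono hQB
      _ = (∫⁻ η, B η) + ∫⁻ η, B η := by
        rw [lintegral_add_left hBm, lintegral_sub_left_eq_self B ξ]
      _ ≤ ENNReal.ofReal (C * (3 * r) ^ (3 - 4 * a)) + ENNReal.ofReal (C * (3 * r) ^ (3 - 4 * a)) := by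
        have := hball (3 * r) (by positivity)
        gcongr
      _ = _ := by
        rw [← ENNReal.ofReal_add (by positivity) (by positivity), mul_pow,
          Real.sq_sqrt (by positivity), ← Real.rpow_natCast, ← Real.rpow_mul hξ.le,
          Real.mul_rpow (by norm_num) hξ.le]
        rw [show (3 / 2 - 2 * a) * ((2 : ℕ) : ℝ) = 3 - 4 * a by push_cast; ring]
        congr 1; ring
  have hP2 : l2n (fun η => φ η * ψ (ξ - η))
      = (cv (fun η => φ η ^ (2 : ℝ)) (fun η => ψ η ^ (2 : ℝ)) ξ) ^ ((1 : ℝ) / 2) := by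
    unfold l2n cv
    congr 1
    refine lintegral_congr fun η => ?_
    rw [ENNReal.mul_rpow_of_nonneg _ _ zero_le_two]
  calc cv (fun η => w η * φ η) (fun η => w η * ψ η) ξ
      ≤ ∫⁻ η, ((φ η * ψ (ξ - η)) * Q η + ENNReal.ofReal (r ^ (-(2 * a))) * (φ η * ψ (ξ - η))) :=
        lintegral_mono hpt
    _ = (∫⁻ η, (φ η * ψ (ξ - η)) * Q η) + ENNReal.ofReal (r ^ (-(2 * a))) * ∫⁻ η, φ η * ψ (ξ - η) := by
        rw [lintegral_add_left (by fun_prop), lintegral_const_mul _ (by fun_prop)]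
    _ ≤ l2n (fun η => φ η * ψ (ξ - η)) * l2n Q +
        ENNReal.ofReal (r ^ (-(2 * a))) * (l2n φ * l2n (fun η => ψ (ξ - η))) := by
        gcongr
        · exact lintegral_mul_le_l2n (by fun_prop) hQm
        · exact lintegral_mul_le_l2n hφ hψr
    _ ≤ _ := by
        rw [l2n_reflect, hP2, mul_comm]
        gcongr

/-- The product estimate with Gaussian damping at output frequency. -/
lemma exists_l2n_cv_weighted_le {δ : ℝ} (hδ : 0 < δ) (hδ1 : δ < 1 / 8) :
    ∃ C > (0 : ℝ), ∀ u : ℝ, 0 < u → ∀ φ ψ : V3 → ℝ≥0∞, Measurable φ → Measurable ψ →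
      l2n (fun ξ => ENNReal.ofReal (en ξ ^ (δ + 3 / 2) * Real.exp (-(u * en ξ ^ 2 / 4))) *
          cv (fun η => ENNReal.ofReal (en η ^ (-(δ + 1 / 2))) * φ η)
            (fun η => ENNReal.ofReal (en η ^ (-(δ + 1 / 2))) * ψ η) ξ)
        ≤ ENNReal.ofReal (C * u ^ (-(1 - δ / 2))) * (l2n φ * l2n ψ) := by
  obtain ⟨C1, hC1, hcv⟩ := exists_cv_weighted_le (a := δ + 1 / 2) (by positivity) (by linarith)
  obtain ⟨C2, hC2, hG⟩ := exists_l2n_gaussian (q := 1 / 2 - δ) (by linarith)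
  obtain ⟨C3, hC3, hE⟩ := exists_rpow_mul_exp_le (p := 2 - δ) (c := 1 / 4) (by linarith) (by norm_num)
  refine ⟨C1 * C3 + C2, by positivity, fun u hu φ ψ hφ hψ => ?_⟩
  set S : V3 → ℝ≥0∞ := fun ξ =>
    (cv (fun η => φ η ^ (2 : ℝ)) (fun η => ψ η ^ (2 : ℝ)) ξ) ^ ((1 : ℝ) / 2) with hS
  have hSm : Measurable S := (measurable_cv (by fun_prop) (by fun_prop)).pow_const _
  have hSn : l2n S = l2n φ * l2n ψ := by
    have : ∀ ξ, S ξ ^ (2 : ℝ) = cv (fun η => φ η ^ (2 : ℝ)) (fun η => ψ η ^ (2 : ℝ)) ξ := by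
      intro ξ; simp only [hS]; rw [← ENNReal.rpow_mul]; norm_num
    unfold l2n
    simp_rw [this]
    rw [lintegral_cv (by fun_prop) (by fun_prop), ENNReal.mul_rpow_of_nonneg _ _ (by norm_num)]
  set G : V3 → ℝ≥0∞ := fun ξ =>
    ENNReal.ofReal (en ξ ^ (1 / 2 - δ) * Real.exp (-(u * en ξ ^ 2 / 4))) with hGdef
  have hpt : ∀ ξ, ENNReal.ofReal (en ξ ^ (δ + 3 / 2) * Real.exp (-(u * en ξ ^ 2 / 4))) *
          cv (fun η => ENNReal.ofReal (en η ^ (-(δ + 1 / 2))) * φ η)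
            (fun η => ENNReal.ofReal (en η ^ (-(δ + 1 / 2))) * ψ η) ξ
      ≤ ENNReal.ofReal (C1 * C3 * u ^ (-(1 - δ / 2))) * S ξ + (l2n φ * l2n ψ) * G ξ := by
    intro ξ
    rcases (en_nonneg ξ).eq_or_lt with h0 | h0
    · rw [← h0, Real.zero_rpow (by positivity)]; simp
    · refine (mul_le_mul_right (hcv φ ψ hφ hψ ξ h0) _).trans ?_
      rw [mul_add, ← mul_assoc, ← mul_assoc, ← ENNReal.ofReal_mul (by positivity),
        ← ENNReal.ofReal_mul (by positivity), mul_comm (l2n φ * l2n ψ)]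
      refine add_le_add (mul_le_mul_left (ENNReal.ofReal_le_ofReal ?_) _)
        (mul_le_mul_left (ENNReal.ofReal_le_ofReal ?_) _)
      · have h1 := hE u (en ξ) hu h0.le
        have e1 : en ξ ^ (2 - δ) = en ξ ^ (δ + 3 / 2) * en ξ ^ (3 / 2 - 2 * (δ + 1 / 2)) := by
          rw [← Real.rpow_add h0]; congr 1; ring
        rw [e1, show (2 - δ) / 2 = 1 - δ / 2 by ring, show -(1 / 4 * (u * en ξ ^ 2))
          = -(u * en ξ ^ 2 / 4) by ring] at h1
        calc _ = C1 * (en ξ ^ (δ + 3 / 2) * en ξ ^ (3 / 2 - 2 * (δ + 1 / 2)) *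
              Real.exp (-(u * en ξ ^ 2 / 4))) := by ring
          _ ≤ C1 * (C3 * u ^ (-(1 - δ / 2))) := by gcongr
          _ = _ := by ring
      · have e1 : en ξ ^ (1 / 2 - δ) = en ξ ^ (δ + 3 / 2) * en ξ ^ (-(2 * (δ + 1 / 2))) := by
          rw [← Real.rpow_add h0]; congr 1; ring
        rw [e1]; apply le_of_eq; ring
  refine (l2n_mono hpt).trans ((l2n_add_le (by fun_prop) (by fun_prop)).trans ?_)
  rw [l2n_const_mul _ hSm, l2n_const_mul _ (by fun_prop), hSn]
  refine (add_le_add le_rfl (mul_le_mul_right (hG u hu) _)).trans ?_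
  rw [mul_comm (l2n φ * l2n ψ) (ENNReal.ofReal _), ← add_mul, ← ENNReal.ofReal_add (by positivity) (by positivity)]
  gcongr
  rw [show (2 * (1 / 2 - δ) + 3) / 4 = 1 - δ / 2 by ring]
  apply le_of_eq; ring

lemma one_le_wH_mul_rpow {p γ : ℝ} (hp : 0 ≤ p) (hpγ : p ≤ γ) {η : V3} (h : 0 < en η) :
    1 ≤ en η ^ (-p) * wH γ η := by
  have h1 : en η ^ p ≤ wH γ η := by
    unfold wH
    calc en η ^ p = (en η ^ 2) ^ (p / 2) := by
          rw [← Real.rpow_natCast, ← Real.rpow_mul h.le]; congr 1; push_cast; ring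
      _ ≤ (1 + en η ^ 2) ^ (p / 2) := by gcongr; linarith
      _ ≤ _ := by
          apply Real.rpow_le_rpow_of_exponent_le
          · nlinarith
          · linarith
  rw [Real.rpow_neg h.le, ← div_eq_inv_mul, one_le_div (by positivity)]
  exact h1

@[fun_prop]
lemma measurable_wH (γ : ℝ) : Measurable (wH γ) := by unfold wH; fun_prop

lemma wH_nonneg (γ : ℝ) (η : V3) : 0 ≤ wH γ η := by unfold wH; positivity

/-- The low-frequency part of a function in `H^γ`, with exponential weight, is in `L¹`. -/
lemma exists_lintegral_low_le {δ γ : ℝ} (hδ : 0 < δ) (hδ1 : δ < 1 / 8) (hγ : 1 / 2 + 2 * δ < γ) :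
    ∃ C > (0 : ℝ), ∀ N s τ : ℝ, 0 < N → 1 ≤ 0.01 * (N * τ) → 0 < s → N * s ≤ τ →
      ∀ f : V3 → ℝ≥0∞, Measurable f →
      ∫⁻ η, (if en η < 0.01 * N then ENNReal.ofReal (Real.exp (N * s * en η)) * f η else 0)
        ≤ ENNReal.ofReal (C * (τ ^ (-(1 - δ)) + Real.exp (0.01 * (N * τ)) * N ^ (3 / 2 - γ))) *
          l2n (fun η => ENNReal.ofReal (wH γ η) * f η) := by
  obtain ⟨C1, hC1, h1⟩ := exists_l2n_rpow_ball (p := 1 / 2 + δ) (by positivity) (by linarith)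
  obtain ⟨C2, hC2, h2⟩ := exists_l2n_rpow_ball (p := 0) le_rfl (by norm_num)
  obtain ⟨K, hK, hexp⟩ := exists_exp_mul_rpow_le (κ := γ) (c := 1) (by linarith) one_pos
  refine ⟨Real.exp 1 * C1 + K * C2 * 0.01 ^ (3 / 2 - γ), by positivity,
    fun N s τ hN hNτ hs hsτ f hf => ?_⟩
  have hτ : 0 < τ := lt_of_lt_of_le (by positivity) hsτ
  set R := 0.01 * N with hR
  have hR0 : 0 < R := by positivity
  set κ1 : V3 → ℝ≥0∞ := fun η => if en η ≤ τ⁻¹ then ENNReal.ofReal (en η ^ (-(1 / 2 + δ))) else 0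
    with hκ1
  set κ2 : V3 → ℝ≥0∞ := fun η => if en η ≤ R then ENNReal.ofReal (en η ^ (-(0 : ℝ))) else 0
    with hκ2
  have hm1 : Measurable κ1 := Measurable.ite (measurableSet_le (by fun_prop) (by fun_prop))
      (by fun_prop) (by fun_prop)
  have hm2 : Measurable κ2 := Measurable.ite (measurableSet_le (by fun_prop) (by fun_prop))
      (by fun_prop) (by fun_prop)
  set B := K * (Real.exp (0.01 * (N * τ)) * R ^ (-γ)) with hB
  have hB0 : 0 ≤ B := by positivity
  set w : V3 → ℝ≥0∞ := fun η => ENNReal.ofReal (wH γ η) * f η with hw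
  have hwm : Measurable w := by fun_prop
  set κ : V3 → ℝ≥0∞ := fun η => ENNReal.ofReal (Real.exp 1) * κ1 η + ENNReal.ofReal B * κ2 η with hκ
  have hκm : Measurable κ := by fun_prop
  have hpt : ∀ᵐ η : V3, (if en η < R then ENNReal.ofReal (Real.exp (N * s * en η)) * f η else 0)
      ≤ κ η * w η := by
    have h0 : ∀ᵐ η : V3, η ≠ 0 := by
      rw [ae_iff]; simp
    filter_upwards [h0] with η hη
    have hpos : 0 < en η := (en_nonneg η).lt_of_ne fun h => hη (en_eq_zero h.symm)
    have hwH := wH_nonneg γ η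
    split_ifs with hηR
    · simp only [hκ, hw]
      rw [← mul_assoc]
      gcongr
      by_cases hη1 : en η ≤ τ⁻¹
      · rw [add_mul]
        refine le_trans ?_ le_self_add
        simp only [hκ1, hη1, if_true]
        rw [← ENNReal.ofReal_mul (by positivity), ← ENNReal.ofReal_mul (by positivity)]
        apply ENNReal.ofReal_le_ofReal
        have e1 : N * s * en η ≤ 1 := by
          calc N * s * en η ≤ τ * τ⁻¹ := by gcongr
            _ = 1 := mul_inv_cancel₀ hτ.ne'
        have e2 := one_le_wH_mul_rpow (p := 1 / 2 + δ) (γ := γ) (by positivity) (by linarith) hpos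
        calc Real.exp (N * s * en η) ≤ Real.exp 1 * 1 := by rw [mul_one]; gcongr
          _ ≤ Real.exp 1 * (en η ^ (-(1 / 2 + δ)) * wH γ η) := by gcongr
          _ = _ := by ring
      · rw [add_mul]
        refine le_trans ?_ le_add_self
        push Not at hη1
        have e0 : en η ≤ R := hηR.le
        simp only [hκ2, e0, if_true]
        rw [← ENNReal.ofReal_mul (by positivity), ← ENNReal.ofReal_mul (by positivity)]
        apply ENNReal.ofReal_le_ofReal
        have e2 := one_le_wH_mul_rpow (p := γ) (γ := γ) (by linarith) le_rfl hpos
        have e3 := hexp (τ * en η) (0.01 * (N * τ))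
          (by rw [← mul_inv_cancel₀ hτ.ne']; gcongr)
          (by rw [show 0.01 * (N * τ) = τ * R by rw [hR]; ring]; gcongr)
        rw [show 0.01 * (N * τ) = τ * R by rw [hR]; ring, one_mul, one_mul,
          Real.mul_rpow hτ.le hpos.le, Real.mul_rpow hτ.le hR0.le] at e3
        have hτγ : 0 < τ ^ (-γ) := by positivity
        have e4 : Real.exp (τ * en η) * en η ^ (-γ) ≤ B := by
          rw [hB, show 0.01 * (N * τ) = τ * R by rw [hR]; ring]
          refine le_of_mul_le_mul_left ?_ hτγ
          calc _ = Real.exp (τ * en η) * (τ ^ (-γ) * en η ^ (-γ)) := by ring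
            _ ≤ _ := e3
            _ = _ := by ring
        rw [neg_zero, Real.rpow_zero, mul_one]
        calc Real.exp (N * s * en η) ≤ Real.exp (τ * en η) * 1 := by rw [mul_one]; gcongr
          _ ≤ Real.exp (τ * en η) * (en η ^ (-γ) * wH γ η) := by gcongr
          _ = Real.exp (τ * en η) * en η ^ (-γ) * wH γ η := by ring
          _ ≤ _ := by gcongr
    · simp
  refine (lintegral_mono_ae hpt).trans ((lintegral_mul_le_l2n hκm hwm).trans ?_)
  refine mul_le_mul_left ?_ _
  refine (l2n_add_le (by fun_prop) (by fun_prop)).trans ?_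
  rw [l2n_const_mul _ hm1, l2n_const_mul _ hm2]
  refine (add_le_add (mul_le_mul_right (h1 τ⁻¹ (by positivity)) _)
    (mul_le_mul_right (h2 R hR0) _)).trans ?_
  rw [← ENNReal.ofReal_mul (by positivity), ← ENNReal.ofReal_mul (by positivity),
    ← ENNReal.ofReal_add (by positivity) (by positivity)]
  apply ENNReal.ofReal_le_ofReal
  have e1 : τ⁻¹ ^ (3 / 2 - (1 / 2 + δ)) = τ ^ (-(1 - δ)) := by
    rw [Real.inv_rpow hτ.le, ← Real.rpow_neg hτ.le]; congr 1; ring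
  have e2 : R ^ (-γ) * R ^ (3 / 2 - 0 : ℝ) = 0.01 ^ (3 / 2 - γ) * N ^ (3 / 2 - γ) := by
    rw [← Real.rpow_add hR0, ← Real.mul_rpow (by norm_num) hN.le]; congr 1; ring
  rw [e1, hB]
  calc _ = Real.exp 1 * C1 * τ ^ (-(1 - δ))
        + K * C2 * Real.exp (0.01 * (N * τ)) * (R ^ (-γ) * R ^ (3 / 2 - 0 : ℝ)) := by ring
    _ = Real.exp 1 * C1 * τ ^ (-(1 - δ)) + K * C2 * 0.01 ^ (3 / 2 - γ) *
        (Real.exp (0.01 * (N * τ)) * N ^ (3 / 2 - γ)) := by rw [e2]; ring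
    _ ≤ _ := by
      rw [mul_add]
      gcongr
      · exact le_add_of_nonneg_right (by positivity)
      · exact le_add_of_nonneg_left (by positivity)

lemma exists_mul_exp_neg_sq_le :
    ∃ C > (0 : ℝ), ∀ N u r : ℝ, 0 < N → 0 < u →
      r * Real.exp (-(u * (r - N / 2) ^ 2)) ≤ C * (N + u ^ (-(1 / 2 : ℝ))) := by
  obtain ⟨C, hC, h⟩ := exists_rpow_mul_exp_le (p := 1) (c := 1) zero_le_one one_pos
  refine ⟨C + 1, by positivity, fun N u r hN hu => ?_⟩
  have h1 := h u |r - N / 2| hu (abs_nonneg _)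
  rw [Real.rpow_one, sq_abs, one_mul] at h1
  have h2 : Real.exp (-(u * (r - N / 2) ^ 2)) ≤ 1 := Real.exp_le_one_iff.2 (by
    have := mul_nonneg hu.le (sq_nonneg (r - N / 2)); linarith)
  have hE := Real.exp_pos (-(u * (r - N / 2) ^ 2))
  have hu' : 0 < u ^ (-(1 / 2 : ℝ)) := by positivity
  calc r * Real.exp (-(u * (r - N / 2) ^ 2))
      ≤ (|r - N / 2| + N / 2) * Real.exp (-(u * (r - N / 2) ^ 2)) := by
        gcongr; linarith [le_abs_self (r - N / 2)]
    _ = |r - N / 2| * Real.exp (-(u * (r - N / 2) ^ 2))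
        + N / 2 * Real.exp (-(u * (r - N / 2) ^ 2)) := by ring
    _ ≤ C * u ^ (-(1 / 2 : ℝ)) + N / 2 * 1 := by gcongr
    _ ≤ _ := by nlinarith [mul_pos hC hN]

/-- Pointwise kernel bound for low-high interactions. -/
lemma exists_kernel_low_high {δ : ℝ} (hδ : 0 < δ) :
    ∃ C > (0 : ℝ), ∀ N s t r x z : ℝ, 0 < N → 0 < s → s < t → x < 0.01 * N →
      0.1 * N ≤ r → r ≤ x + z →
      t ^ (δ / 2) * r ^ (δ + 1 / 2) * Real.exp (N * t * r - N ^ 2 * t / 4) *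
          (Real.exp (-((t - s) * r ^ 2)) * r)
        ≤ C * (t ^ (δ / 2) * s ^ (-(δ / 2)) * (N + (t - s) ^ (-(1 / 2 : ℝ)))) *
          Real.exp (N * s * x) * (s ^ (δ / 2) * z ^ (δ + 1 / 2) *
            Real.exp (-(N ^ 2 * s / 4) + N * s * z)) := by
  obtain ⟨C, hC, h⟩ := exists_mul_exp_neg_sq_le
  refine ⟨C * 2 ^ (δ + 1 / 2), by positivity, fun N s t r x z hN hs hst hx hr hrxz => ?_⟩
  have ht : 0 < t := by linarith
  have hu : 0 < t - s := by linarith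
  have hr0 : 0 < r := by linarith
  have hz : r ≤ 2 * z := by linarith
  have hz0 : 0 < z := by linarith
  have h1 := h N (t - s) r hN hu
  have e1 : Real.exp (N * t * r - N ^ 2 * t / 4) * (Real.exp (-((t - s) * r ^ 2)) * r)
      = Real.exp (N * s * r - N ^ 2 * s / 4) * (r * Real.exp (-((t - s) * (r - N / 2) ^ 2))) := by
    rw [← mul_assoc, ← Real.exp_add, mul_comm r, ← mul_assoc, ← Real.exp_add]
    congr 2; ring
  have e2 : s ^ (-(δ / 2)) * s ^ (δ / 2) = 1 := by
    rw [← Real.rpow_add hs]; simp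
  have e3 : r ^ (δ + 1 / 2) ≤ 2 ^ (δ + 1 / 2) * z ^ (δ + 1 / 2) := by
    rw [← Real.mul_rpow zero_le_two hz0.le]; gcongr
  have e4 : Real.exp (N * s * r - N ^ 2 * s / 4)
      ≤ Real.exp (N * s * x) * Real.exp (-(N ^ 2 * s / 4) + N * s * z) := by
    rw [← Real.exp_add]
    apply Real.exp_le_exp.2
    have := mul_le_mul_of_nonneg_left hrxz (show 0 ≤ N * s by positivity)
    linarith
  calc _ = t ^ (δ / 2) * r ^ (δ + 1 / 2) * (Real.exp (N * t * r - N ^ 2 * t / 4) *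
          (Real.exp (-((t - s) * r ^ 2)) * r)) := by ring
    _ ≤ t ^ (δ / 2) * (2 ^ (δ + 1 / 2) * z ^ (δ + 1 / 2)) *
        ((Real.exp (N * s * x) * Real.exp (-(N ^ 2 * s / 4) + N * s * z)) *
          (C * (N + (t - s) ^ (-(1 / 2 : ℝ))))) := by
        rw [e1]
        gcongr
    _ = (s ^ (-(δ / 2)) * s ^ (δ / 2)) * (t ^ (δ / 2) * (2 ^ (δ + 1 / 2) * z ^ (δ + 1 / 2)) *
        ((Real.exp (N * s * x) * Real.exp (-(N ^ 2 * s / 4) + N * s * z)) *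
          (C * (N + (t - s) ^ (-(1 / 2 : ℝ)))))) := by rw [e2, one_mul]
    _ = _ := by ring

/-- Pointwise kernel bound for high-high interactions. -/
lemma kernel_high_high {δ N s t r x z : ℝ} (hN : 0 < N) (hs : 0 < s) (hst : s < t)
    (hr : 0 < r) (hrxz : r ≤ x + z) :
    t ^ (δ / 2) * r ^ (δ + 1 / 2) * Real.exp (N * t * r - N ^ 2 * t / 4) *
        (Real.exp (-((t - s) * r ^ 2)) * r)
      ≤ (t ^ (δ / 2) * s ^ (-δ) * Real.exp (-(0.1 * (N ^ 2 * (t - s)))) *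
          Real.exp (N ^ 2 * t / 4)) *
        (r ^ (δ + 3 / 2) * Real.exp (-((t - s) * r ^ 2 / 4))) *
        ((s ^ (δ / 2) * Real.exp (-(N ^ 2 * s / 4) + N * s * x)) *
          (s ^ (δ / 2) * Real.exp (-(N ^ 2 * s / 4) + N * s * z))) := by
  have ht : 0 < t := by linarith
  have hu : 0 < t - s := by linarith
  have e2 : s ^ (-δ) * (s ^ (δ / 2) * s ^ (δ / 2)) = 1 := by
    rw [← Real.rpow_add hs, ← Real.rpow_add hs]; ring_nf; simp
  have e3 : r ^ (δ + 3 / 2) = r ^ (δ + 1 / 2) * r := by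
    rw [← Real.rpow_add_one hr.ne']; congr 1; ring
  have e4 : Real.exp (N * t * r - N ^ 2 * t / 4) * Real.exp (-((t - s) * r ^ 2))
      ≤ Real.exp (-(0.1 * (N ^ 2 * (t - s)))) * Real.exp (N ^ 2 * t / 4) *
        Real.exp (-((t - s) * r ^ 2 / 4)) * (Real.exp (-(N ^ 2 * s / 4) + N * s * x) *
          Real.exp (-(N ^ 2 * s / 4) + N * s * z)) := by
    simp only [← Real.exp_add]
    apply Real.exp_le_exp.2
    have h1 := mul_le_mul_of_nonneg_left hrxz (show 0 ≤ N * s by positivity)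
    have h2 : 0 ≤ 3 * r ^ 2 / 4 - r * N + 0.4 * N ^ 2 := by nlinarith [sq_nonneg (3 * r - 2 * N)]
    have h3 := mul_nonneg hu.le h2
    nlinarith
  calc _ = t ^ (δ / 2) * (r ^ (δ + 1 / 2) * r) * (Real.exp (N * t * r - N ^ 2 * t / 4) *
          Real.exp (-((t - s) * r ^ 2))) := by ring
    _ ≤ t ^ (δ / 2) * (r ^ (δ + 1 / 2) * r) *
        (Real.exp (-(0.1 * (N ^ 2 * (t - s)))) * Real.exp (N ^ 2 * t / 4) *
        Real.exp (-((t - s) * r ^ 2 / 4)) * (Real.exp (-(N ^ 2 * s / 4) + N * s * x) *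
          Real.exp (-(N ^ 2 * s / 4) + N * s * z))) := by gcongr
    _ = (s ^ (-δ) * (s ^ (δ / 2) * s ^ (δ / 2))) * (t ^ (δ / 2) * (r ^ (δ + 1 / 2) * r) *
        (Real.exp (-(0.1 * (N ^ 2 * (t - s)))) * Real.exp (N ^ 2 * t / 4) *
        Real.exp (-((t - s) * r ^ 2 / 4)) * (Real.exp (-(N ^ 2 * s / 4) + N * s * x) *
          Real.exp (-(N ^ 2 * s / 4) + N * s * z)))) := by rw [e2, one_mul]
    _ = _ := by rw [e3]; ring

/-- The weight of the working norm at time `s`, written in terms of `N = λ T^{-1/2}`. -/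
def xw (δ N s : ℝ) (η : V3) : ℝ :=
  if 0.01 * N ≤ en η then
    s ^ (δ / 2) * en η ^ (δ + 1 / 2) * Real.exp (-(N ^ 2 * s / 4) + N * s * en η)
  else 0

@[fun_prop]
lemma measurable_xw (δ N s : ℝ) : Measurable (xw δ N s) :=
  Measurable.ite (measurableSet_le (by fun_prop) (by fun_prop)) (by fun_prop) (by fun_prop)

/-- Spatial estimate of the bilinear term at fixed times `s < t`. -/
lemma exists_l2n_bilinear_le {δ γ : ℝ} (hδ : 0 < δ) (hδ1 : δ < 1 / 8) (hγ : 1 / 2 + 2 * δ < γ) :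
    ∃ C > (0 : ℝ), ∀ N s t τ : ℝ, 0 < N → 0 < s → s < t → 1 ≤ 0.01 * (N * τ) → N * s ≤ τ →
      ∀ f g : V3 → ℝ≥0∞, Measurable f → Measurable g →
      l2n (fun ξ => if 0.1 * N ≤ en ξ then
          ENNReal.ofReal (t ^ (δ / 2) * en ξ ^ (δ + 1 / 2) * Real.exp (N * t * en ξ - N ^ 2 * t / 4) *
            (Real.exp (-((t - s) * en ξ ^ 2)) * en ξ)) * cv f g ξ else 0)
        ≤ ENNReal.ofReal (C * (t ^ (δ / 2) * s ^ (-δ) * (t - s) ^ (-(1 - δ / 2)) *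
              Real.exp (-(0.1 * (N ^ 2 * (t - s)))) * Real.exp (N ^ 2 * t / 4))) *
            (l2n (fun η => ENNReal.ofReal (xw δ N s η) * f η) *
              l2n (fun η => ENNReal.ofReal (xw δ N s η) * g η)) +
          ENNReal.ofReal (C * (τ ^ (-(1 - δ)) + Real.exp (0.01 * (N * τ)) * N ^ (3 / 2 - γ)) *
              (t ^ (δ / 2) * s ^ (-(δ / 2)) * (N + (t - s) ^ (-(1 / 2 : ℝ))))) *
            (l2n (fun η => ENNReal.ofReal (wH γ η) * f η) *
                l2n (fun η => ENNReal.ofReal (xw δ N s η) * g η) +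
              l2n (fun η => ENNReal.ofReal (xw δ N s η) * f η) *
                l2n (fun η => ENNReal.ofReal (wH γ η) * g η)) := by
  obtain ⟨C1, hC1, hhh⟩ := exists_l2n_cv_weighted_le hδ hδ1
  obtain ⟨C2, hC2, hlow⟩ := exists_lintegral_low_le hδ hδ1 hγ
  obtain ⟨C3, hC3, hker⟩ := exists_kernel_low_high hδ
  refine ⟨C1 + C2 * C3, by positivity, fun N s t τ hN hs hst hNτ hsτ f g hf hg => ?_⟩
  have ht : 0 < t := by linarith
  have hu : 0 < t - s := by linarith
  have hτ : 0 < τ := lt_of_lt_of_le (by positivity) hsτ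
  set A := t ^ (δ / 2) * s ^ (-δ) * Real.exp (-(0.1 * (N ^ 2 * (t - s)))) *
          Real.exp (N ^ 2 * t / 4) with hA
  have hA0 : 0 ≤ A := by positivity
  set B := C3 * (t ^ (δ / 2) * s ^ (-(δ / 2)) * (N + (t - s) ^ (-(1 / 2 : ℝ)))) with hB
  have hB0 : 0 ≤ B := by positivity
  set D := C2 * (τ ^ (-(1 - δ)) + Real.exp (0.01 * (N * τ)) * N ^ (3 / 2 - γ)) with hD
  have hD0 : 0 ≤ D := by positivity
  set low : (V3 → ℝ≥0∞) → V3 → ℝ≥0∞ := fun f η =>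
    if en η < 0.01 * N then ENNReal.ofReal (Real.exp (N * s * en η)) * f η else 0 with hlowdef
  set x : (V3 → ℝ≥0∞) → V3 → ℝ≥0∞ := fun f η => ENNReal.ofReal (xw δ N s η) * f η with hx
  set p : (V3 → ℝ≥0∞) → V3 → ℝ≥0∞ := fun f η =>
    ENNReal.ofReal (en η ^ (-(δ + 1 / 2))) * x f η with hp
  have hlm : ∀ f, Measurable f → Measurable (low f) := fun f hf =>
    Measurable.ite (measurableSet_lt (by fun_prop) (by fun_prop)) (by fun_prop) (by fun_prop)
  have hxm : ∀ f, Measurable f → Measurable (x f) := fun f hf => by simp only [hx]; fun_prop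
  have hpm : ∀ f, Measurable f → Measurable (p f) := fun f hf => by
    have := hxm f hf
    simp only [hp]; fun_prop
  have hphigh : ∀ f η, 0.01 * N ≤ en η →
      p f η = ENNReal.ofReal (s ^ (δ / 2) * Real.exp (-(N ^ 2 * s / 4) + N * s * en η)) * f η := by
    intro f η h
    have h0 : 0 < en η := lt_of_lt_of_le (by positivity) h
    simp only [hp, hx, xw, h, if_true]
    rw [← mul_assoc, ← ENNReal.ofReal_mul (by positivity)]
    congr 2
    have : en η ^ (-(δ + 1 / 2)) * en η ^ (δ + 1 / 2) = 1 := by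
      rw [← Real.rpow_add h0]; simp
    calc _ = (en η ^ (-(δ + 1 / 2)) * en η ^ (δ + 1 / 2)) *
          (s ^ (δ / 2) * Real.exp (-(N ^ 2 * s / 4) + N * s * en η)) := by ring
      _ = _ := by rw [this, one_mul]
  set G : V3 → ℝ≥0∞ := fun ξ =>
    ENNReal.ofReal (en ξ ^ (δ + 3 / 2) * Real.exp (-((t - s) * en ξ ^ 2 / 4))) with hG
  have hGm : Measurable G := by simp only [hG]; fun_prop
  have hlf := hlm f hf
  have hlg := hlm g hg
  have hxf := hxm f hf
  have hxg := hxm g hg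
  have hpf := hpm f hf
  have hpg := hpm g hg
  have hmp := measurable_cv hpf hpg
  have hm1 := measurable_cv hlf hxg
  have hm2 := measurable_cv hxf hlg
  have hpt : ∀ ξ, (if 0.1 * N ≤ en ξ then
          ENNReal.ofReal (t ^ (δ / 2) * en ξ ^ (δ + 1 / 2) * Real.exp (N * t * en ξ - N ^ 2 * t / 4) *
            (Real.exp (-((t - s) * en ξ ^ 2)) * en ξ)) * cv f g ξ else 0)
      ≤ ENNReal.ofReal A * (G ξ * cv (p f) (p g) ξ) +
        ENNReal.ofReal B * (cv (low f) (x g) ξ + cv (x f) (low g) ξ) := by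
    intro ξ
    split_ifs with hξ
    swap
    · exact zero_le
    have hξ0 : 0 < en ξ := lt_of_lt_of_le (by positivity) hξ
    set K := t ^ (δ / 2) * en ξ ^ (δ + 1 / 2) * Real.exp (N * t * en ξ - N ^ 2 * t / 4) *
            (Real.exp (-((t - s) * en ξ ^ 2)) * en ξ) with hK
    have hK0 : 0 ≤ K := by positivity
    unfold cv
    rw [← lintegral_const_mul _ (by fun_prop), ← lintegral_const_mul _ (by fun_prop),
      ← lintegral_const_mul _ (by fun_prop), ← lintegral_add_left (by fun_prop),
      ← lintegral_const_mul _ (by fun_prop), ← lintegral_add_left (by fun_prop)]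
    refine lintegral_mono fun η => ?_
    have htri := en_le_add_sub ξ η
    by_cases h1 : en η < 0.01 * N
    · refine le_trans ?_ (le_add_self.trans le_rfl)
      rw [mul_add]
      refine le_trans ?_ le_self_add
      have h2 : 0.01 * N ≤ en (ξ - η) := by linarith
      have hz := en_nonneg (ξ - η)
      simp only [hlowdef, hx, xw, h1, h2, if_true]
      rw [show ∀ a b c d e : ℝ≥0∞, a * (b * c * (d * e)) = (a * b * d) * (c * e) by intros; ring,
        ← ENNReal.ofReal_mul (by positivity), ← ENNReal.ofReal_mul (by positivity)]
      refine mul_le_mul_left (ENNReal.ofReal_le_ofReal ?_) _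
      exact hker N s t (en ξ) (en η) (en (ξ - η)) hN hs hst h1 hξ htri
    · push Not at h1
      by_cases h2 : en (ξ - η) < 0.01 * N
      · refine le_trans ?_ (le_add_self.trans le_rfl)
        rw [mul_add]
        refine le_trans ?_ le_add_self
        have hz := en_nonneg η
        simp only [hlowdef, hx, xw, h1, h2, if_true]
        rw [show ∀ a b c d e : ℝ≥0∞, a * (b * c * (d * e)) = (a * d * b) * (c * e) by intros; ring,
          ← ENNReal.ofReal_mul (by positivity), ← ENNReal.ofReal_mul (by positivity)]
        refine mul_le_mul_left (ENNReal.ofReal_le_ofReal ?_) _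
        exact hker N s t (en ξ) (en (ξ - η)) (en η) hN hs hst h2 hξ (by linarith)
      · push Not at h2
        refine le_trans ?_ le_self_add
        rw [hphigh f _ h1, hphigh g _ h2]
        simp only [hG]
        rw [show ∀ a b c d e h : ℝ≥0∞, a * (h * (b * c * (d * e))) = (a * h * (b * d)) * (c * e) by
          intros; ring, ← ENNReal.ofReal_mul (by positivity), ← ENNReal.ofReal_mul (by positivity),
          ← ENNReal.ofReal_mul (by positivity)]
        refine mul_le_mul_left (ENNReal.ofReal_le_ofReal ?_) _
        exact kernel_high_high hN hs hst hξ0 htri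
  refine (l2n_mono hpt).trans ?_
  refine (l2n_add_le (by fun_prop) (by fun_prop)).trans ?_
  rw [l2n_const_mul _ (by fun_prop), l2n_const_mul _ (by fun_prop)]
  refine add_le_add ?_ ?_
  · refine (mul_le_mul_right (hhh (t - s) hu (x f) (x g) hxf hxg) _).trans ?_
    rw [← mul_assoc, ← ENNReal.ofReal_mul (by positivity)]
    refine mul_le_mul_left (ENNReal.ofReal_le_ofReal ?_) _
    calc A * (C1 * (t - s) ^ (-(1 - δ / 2))) = C1 * (t ^ (δ / 2) * s ^ (-δ) *
          (t - s) ^ (-(1 - δ / 2)) * Real.exp (-(0.1 * (N ^ 2 * (t - s)))) *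
          Real.exp (N ^ 2 * t / 4)) := by rw [hA]; ring
      _ ≤ _ := by
        gcongr
        exact le_add_of_nonneg_right (by positivity)
  · have e1 := hlow N s τ hN hNτ hs hsτ f hf
    have e2 := hlow N s τ hN hNτ hs hsτ g hg
    have hsum : l2n (fun ξ => cv (low f) (x g) ξ + cv (x f) (low g) ξ) ≤
        ENNReal.ofReal D * (l2n (fun η => ENNReal.ofReal (wH γ η) * f η) * l2n (x g) +
          l2n (x f) * l2n (fun η => ENNReal.ofReal (wH γ η) * g η)) := by
      refine (l2n_add_le hm1 hm2).trans ?_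
      rw [cv_comm (x f) (low g), mul_add]
      refine add_le_add ((l2n_cv_le hlf hxg).trans ?_) ((l2n_cv_le hlg hxf).trans ?_)
      · refine (mul_le_mul_left e1 _).trans (le_of_eq ?_)
        ring
      · refine (mul_le_mul_left e2 _).trans (le_of_eq ?_)
        ring
    refine (mul_le_mul_right hsum _).trans ?_
    rw [← mul_assoc, ← ENNReal.ofReal_mul (by positivity)]
    refine mul_le_mul_left (ENNReal.ofReal_le_ofReal ?_) _
    calc B * D = (C2 * C3) * (τ ^ (-(1 - δ)) + Real.exp (0.01 * (N * τ)) * N ^ (3 / 2 - γ)) *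
              (t ^ (δ / 2) * s ^ (-(δ / 2)) * (N + (t - s) ^ (-(1 / 2 : ℝ)))) := by
          rw [hB, hD]; ring
      _ ≤ _ := by
        gcongr
        exact le_add_of_nonneg_left hC1.le

/-- The `ℓ¹`-magnitude of a vector in `ℂ³`. -/
def sn (v : Fin 3 → ℂ) : ℝ≥0∞ := ENNReal.ofReal (∑ j, ‖v j‖)

lemma enorm_apply_le_sn (v : Fin 3 → ℂ) (j : Fin 3) : ‖v j‖ₑ ≤ sn v := by
  rw [← ofReal_norm]
  exact ENNReal.ofReal_le_ofReal
    (Finset.single_le_sum (f := fun j => ‖v j‖) (fun _ _ => norm_nonneg _) (Finset.mem_univ j))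

lemma sn_eq_sum (v : Fin 3 → ℂ) : sn v = ∑ j, ‖v j‖ₑ := by
  unfold sn
  rw [ENNReal.ofReal_sum_of_nonneg fun _ _ => norm_nonneg _]
  simp_rw [ofReal_norm]

lemma wnorm_le_l2n {w : V3 → ℝ} (hw : ∀ ξ, 0 ≤ w ξ) (V : V3 → Fin 3 → ℂ) :
    wnorm w V ≤ l2n (fun ξ => ENNReal.ofReal (w ξ) * sn (V ξ)) := by
  unfold wnorm l2n
  gcongr with ξ
  have h0 : 0 ≤ ∑ j, ‖V ξ j‖ := Finset.sum_nonneg fun _ _ => norm_nonneg _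
  unfold sn vnSq
  beta_reduce
  rw [← ENNReal.ofReal_mul (hw ξ), ofReal_rpow_two (mul_nonneg (hw ξ) h0), mul_pow]
  apply ENNReal.ofReal_le_ofReal
  gcongr
  exact Finset.sum_sq_le_sq_sum_of_nonneg fun _ _ => norm_nonneg _

lemma l2n_le_wnorm {w : V3 → ℝ} (hw : ∀ ξ, 0 ≤ w ξ) (V : V3 → Fin 3 → ℂ) :
    l2n (fun ξ => ENNReal.ofReal (w ξ) * sn (V ξ)) ≤ 3 * wnorm w V := by
  apply le_of_rpow_two_le
  rw [l2n_rpow_two, ENNReal.mul_rpow_of_nonneg _ _ zero_le_two]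
  unfold wnorm
  rw [← ENNReal.rpow_mul, show (1 : ℝ) / 2 * 2 = 1 by norm_num, ENNReal.rpow_one,
    ← lintegral_const_mul' _ _ (by simp)]
  refine lintegral_mono fun ξ => ?_
  have h0 : 0 ≤ ∑ j, ‖V ξ j‖ := Finset.sum_nonneg fun _ _ => norm_nonneg _
  have h3 : (3 : ℝ≥0∞) = ENNReal.ofReal 3 := by simp
  unfold sn vnSq
  rw [← ENNReal.ofReal_mul (hw ξ), ofReal_rpow_two (mul_nonneg (hw ξ) h0), mul_pow, h3,
    ofReal_rpow_two (by norm_num), ← ENNReal.ofReal_mul (by norm_num)]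
  apply ENNReal.ofReal_le_ofReal
  have h1 : (∑ j, ‖V ξ j‖) ^ 2 ≤ 3 * ∑ j, ‖V ξ j‖ ^ 2 := by
    simpa using sq_sum_le_card_mul_sum_sq (s := Finset.univ) (f := fun j => ‖V ξ j‖)
  have h2 : 0 ≤ ∑ j, ‖V ξ j‖ ^ 2 := by positivity
  calc w ξ ^ 2 * (∑ j, ‖V ξ j‖) ^ 2 ≤ w ξ ^ 2 * (3 ^ 2 * ∑ j, ‖V ξ j‖ ^ 2) := by
        gcongr; linarith
    _ = _ := by ring

lemma exists_abs_qsym_le (α : Coeffs) :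
    ∃ M ≥ (0 : ℝ), ∀ j m k l ξ, |qsym α j m k l ξ| ≤ M := by
  refine ⟨∑ i : Fin 3 × Fin 3 × Fin 3 × Fin 3, ∑ n, ∑ p, |α i.1 i.2.1 n p i.2.2.1 i.2.2.2|,
    by positivity, fun j m k l ξ => ?_⟩
  refine le_trans ?_ (Finset.single_le_sum
    (f := fun i : Fin 3 × Fin 3 × Fin 3 × Fin 3 =>
      ∑ n, ∑ p, |α i.1 i.2.1 n p i.2.2.1 i.2.2.2|)
    (fun _ _ => by positivity) (Finset.mem_univ (j, m, k, l)))
  refine (Finset.abs_sum_le_sum_abs _ _).trans (Finset.sum_le_sum fun n _ => ?_)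
  refine (Finset.abs_sum_le_sum_abs _ _).trans (Finset.sum_le_sum fun p _ => ?_)
  have h0 := en_nonneg ξ
  rw [abs_div, abs_mul, abs_mul, abs_of_nonneg (sq_nonneg (en ξ)), mul_div_assoc]
  refine mul_le_of_le_one_right (abs_nonneg _) (div_le_one_of_le₀ ?_ (sq_nonneg _))
  rw [sq]
  exact mul_le_mul (abs_apply_le_en ξ n) (abs_apply_le_en ξ p) (abs_nonneg _) h0

lemma exists_enorm_Qhat_le (α : Coeffs) :
    ∃ C > (0 : ℝ), ∀ U W ξ j, ‖Qhat α U W ξ j‖ₑ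
      ≤ ENNReal.ofReal (C * en ξ) * cv (fun η => sn (U η)) (fun η => sn (W η)) ξ := by
  obtain ⟨M, hM, hq⟩ := exists_abs_qsym_le α
  refine ⟨27 * M + 1, by positivity, fun U W ξ j => ?_⟩
  have h0 := en_nonneg ξ
  have hterm : ∀ k l m : Fin 3, ‖(qsym α j m k l ξ : ℂ) * (Complex.I * (ξ m : ℂ)) *
      ((((2 * Real.pi) ^ (3 : ℕ))⁻¹ : ℝ) : ℂ) * ∫ η : V3, U η k * W (ξ - η) l‖ₑ
      ≤ ENNReal.ofReal (M * en ξ) * cv (fun η => sn (U η)) (fun η => sn (W η)) ξ := by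
    intro k l m
    rw [enorm_mul]
    refine mul_le_mul' ?_ ?_
    · rw [← ofReal_norm]
      apply ENNReal.ofReal_le_ofReal
      have hpi : ((2 * Real.pi) ^ (3 : ℕ))⁻¹ ≤ 1 := by
        apply inv_le_one_of_one_le₀
        apply one_le_pow₀
        linarith [Real.pi_gt_three]
      rw [norm_mul, norm_mul, norm_mul, Complex.norm_I, one_mul, Complex.norm_real,
        Complex.norm_real, Complex.norm_real, Real.norm_eq_abs, Real.norm_eq_abs,
        Real.norm_of_nonneg (by positivity)]
      calc _ ≤ M * en ξ * 1 := by
            gcongr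
            · exact hq j m k l ξ
            · exact abs_apply_le_en ξ m
        _ = _ := mul_one _
    · refine (enorm_integral_le_lintegral_enorm _).trans (lintegral_mono fun η => ?_)
      rw [enorm_mul]
      exact mul_le_mul' (enorm_apply_le_sn _ _) (enorm_apply_le_sn _ _)
  unfold Qhat
  have hsum : ∀ X : Fin 3 → Fin 3 → Fin 3 → ℂ, ∀ b : ℝ≥0∞, (∀ k l m, ‖X k l m‖ₑ ≤ b) →
      ‖∑ k, ∑ l, ∑ m, X k l m‖ₑ ≤ 27 * b := by
    intro X b hX
    calc _ ≤ ∑ _k : Fin 3, ∑ _l : Fin 3, ∑ _m : Fin 3, b :=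
          (enorm_sum_le _ _).trans <| Finset.sum_le_sum fun k _ =>
          (enorm_sum_le _ _).trans <| Finset.sum_le_sum fun l _ =>
          (enorm_sum_le _ _).trans <| Finset.sum_le_sum fun m _ => hX k l m
      _ = _ := by simp; rw [← mul_assoc, ← mul_assoc]; norm_num
  refine (hsum _ _ hterm).trans ?_
  rw [← mul_assoc]
  refine mul_le_mul_left ?_ _
  rw [show (27 : ℝ≥0∞) = ENNReal.ofReal 27 by simp, ← ENNReal.ofReal_mul (by norm_num)]
  apply ENNReal.ofReal_le_ofReal
  nlinarith

lemma lam_mul_div_sqrt {T : ℝ} (lam t r : ℝ) (hT : 0 < T) :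
    lam * t / Real.sqrt T * r = lam * T ^ (-(1 : ℝ) / 2) * t * r := by
  rw [neg_div, Real.rpow_neg hT.le, ← Real.sqrt_eq_rpow]; field_simp

lemma lam_sq_mul_div {T : ℝ} (lam t : ℝ) (hT : 0 < T) :
    lam ^ 2 * t / (4 * T) = (lam * T ^ (-(1 : ℝ) / 2)) ^ 2 * t / 4 := by
  rw [neg_div, Real.rpow_neg hT.le, ← Real.sqrt_eq_rpow, mul_pow, inv_pow, Real.sq_sqrt hT.le]
  field_simp

/-- Final bookkeeping of the powers of `λ` and `T`. -/
lemma low_high_coeff_le {δ γ T lam N : ℝ} (hδ1 : δ ≤ 1) (hγ : 0 ≤ γ) (hT : 0 < T) (hlam : 1 ≤ lam)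
    (hN : N = lam * T ^ (-(1 : ℝ) / 2)) :
    ((N * T) ^ (-(1 - δ)) + Real.exp (0.01 * (N * (N * T))) * N ^ (3 / 2 - γ)) * (N * T)
      ≤ lam ^ ((2 : ℝ) - δ) * T ^ (δ / 2) * (1 + lam ^ (1 / 2 + δ + γ) * T ^ ((γ - 1 / 2 - δ) / 2) *
          Real.exp (0.01 * lam ^ 2)) := by
  have hl : 0 < lam := by linarith
  have hNT : N * T = lam * T ^ (1 / 2 : ℝ) := by
    have : T ^ (1 / 2 : ℝ) = T ^ (-(1 : ℝ) / 2) * T := by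
      rw [← Real.rpow_add_one hT.ne']; norm_num
    rw [hN, this]; ring
  have hNNT : N * (N * T) = lam ^ 2 := by
    have : T ^ (-(1 : ℝ) / 2) * T ^ (1 / 2 : ℝ) = 1 := by
      rw [← Real.rpow_add hT]; norm_num
    rw [hNT, hN]
    calc _ = lam ^ 2 * (T ^ (-(1 : ℝ) / 2) * T ^ (1 / 2 : ℝ)) := by ring
      _ = _ := by rw [this, mul_one]
  have hNT0 : 0 < N * T := by rw [hNT]; positivity
  have hN0 : 0 < N := by rw [hN]; positivity
  have h1 : (N * T) ^ (-(1 - δ)) * (N * T) ≤ lam ^ ((2 : ℝ) - δ) * T ^ (δ / 2) := by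
    rw [← Real.rpow_add_one hNT0.ne', hNT, Real.mul_rpow hl.le (by positivity), ← Real.rpow_mul hT.le,
      show -(1 - δ) + 1 = δ by ring, show 1 / 2 * δ = δ / 2 by ring]
    gcongr
    linarith
  have h2 : N ^ (3 / 2 - γ) * (N * T) ≤ lam ^ ((2 : ℝ) - δ) * T ^ (δ / 2) *
      (lam ^ (1 / 2 + δ + γ) * T ^ ((γ - 1 / 2 - δ) / 2)) := by
    have e1 : N ^ (3 / 2 - γ) * (N * T) = lam ^ (5 / 2 - γ) * T ^ ((γ - 1 / 2) / 2) := by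
      rw [← mul_assoc, ← Real.rpow_add_one hN0.ne', hN, Real.mul_rpow hl.le (by positivity),
        ← Real.rpow_mul hT.le, mul_assoc, ← Real.rpow_add_one hT.ne']
      congr 2 <;> ring
    have e2 : lam ^ ((2 : ℝ) - δ) * T ^ (δ / 2) *
        (lam ^ (1 / 2 + δ + γ) * T ^ ((γ - 1 / 2 - δ) / 2))
        = lam ^ (5 / 2 + γ) * T ^ ((γ - 1 / 2) / 2) := by
      rw [mul_mul_mul_comm, ← Real.rpow_add hl, ← Real.rpow_add hT]
      congr 2 <;> ring
    rw [e1, e2]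
    gcongr
    linarith
  rw [hNNT, add_mul, mul_add, mul_one]
  refine add_le_add h1 ?_
  calc _ = N ^ (3 / 2 - γ) * (N * T) * Real.exp (0.01 * lam ^ 2) := by ring
    _ ≤ lam ^ ((2 : ℝ) - δ) * T ^ (δ / 2) * (lam ^ (1 / 2 + δ + γ) *
        T ^ ((γ - 1 / 2 - δ) / 2)) * Real.exp (0.01 * lam ^ 2) := by gcongr
    _ = _ := by ring

lemma measurable_sn_uncurry {F : ℝ → V3 → Fin 3 → ℂ} (hF : MeasVF F) :
    Measurable (fun p : ℝ × V3 => sn (F p.1 p.2)) := by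
  have h : ∀ j, Measurable (fun p : ℝ × V3 => F p.1 p.2 j) := hF
  unfold sn
  fun_prop

lemma measurable_cv_uncurry {f g : ℝ × V3 → ℝ≥0∞} (hf : Measurable f) (hg : Measurable g) :
    Measurable (fun p : ℝ × V3 => cv (fun η => f (p.1, η)) (fun η => g (p.1, η)) p.2) :=
  Measurable.lintegral_prod_right'
    (f := fun q : (ℝ × V3) × V3 => f (q.1.1, q.2) * g (q.1.1, q.1.2 - q.2)) (by fun_prop)

lemma xw_nonneg {δ N s : ℝ} (hs : 0 ≤ s) (η : V3) : 0 ≤ xw δ N s η := by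
  have := en_nonneg η
  unfold xw
  split_ifs <;> positivity

lemma l2n_xw_le_Xnorm {δ lam T s : ℝ} (hT : 0 < T) (hs : s ∈ Icc 0 T) (A : ℝ → V3 → Fin 3 → ℂ) :
    l2n (fun η => ENNReal.ofReal (xw δ (lam * T ^ (-(1 : ℝ) / 2)) s η) * sn (A s η))
      ≤ 3 * Xnorm δ lam T A := by
  refine (l2n_le_wnorm (xw_nonneg hs.1) (A s)).trans ?_
  refine mul_le_mul_right ?_ _
  unfold Xnorm
  refine le_trans (le_of_eq ?_) (le_iSup₂ s hs)
  congr 1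
  funext ξ
  simp only [xw, lam_mul_div_sqrt lam s _ hT, lam_sq_mul_div lam s hT]

lemma l2n_wH_le_supH {γ T s : ℝ} (hs : s ∈ Icc 0 T) (A : ℝ → V3 → Fin 3 → ℂ) :
    l2n (fun η => ENNReal.ofReal (wH γ η) * sn (A s η)) ≤ 3 * supH γ T A := by
  refine (l2n_le_wnorm (wH_nonneg γ) (A s)).trans (mul_le_mul_right ?_ _)
  exact le_iSup₂ (f := fun t (_ : t ∈ Icc 0 T) => wnorm (wH γ) (A t)) s hs

/-- Pointwise bound of the Duhamel term. -/
lemma exists_sn_duhamel_le (α : Coeffs) :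
    ∃ C > (0 : ℝ), ∀ t : ℝ, 0 < t → ∀ F G : ℝ → V3 → Fin 3 → ℂ, ∀ ξ : V3,
      sn (fun j => ∫ s in (0 : ℝ)..t,
          (Real.exp (-((t - s) * en ξ ^ 2)) : ℂ) * Qhat α (F s) (G s) ξ j)
        ≤ ENNReal.ofReal C * ∫⁻ s in Ioo 0 t, ENNReal.ofReal (Real.exp (-((t - s) * en ξ ^ 2)) * en ξ) *
            cv (fun η => sn (F s η)) (fun η => sn (G s η)) ξ := by
  obtain ⟨C, hC, h⟩ := exists_enorm_Qhat_le α
  refine ⟨3 * C, by positivity, fun t ht F G ξ => ?_⟩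
  have h0 := en_nonneg ξ
  have hj : ∀ j, ‖∫ s in (0 : ℝ)..t,
          (Real.exp (-((t - s) * en ξ ^ 2)) : ℂ) * Qhat α (F s) (G s) ξ j‖ₑ
      ≤ ENNReal.ofReal C * ∫⁻ s in Ioo 0 t, ENNReal.ofReal (Real.exp (-((t - s) * en ξ ^ 2)) * en ξ) *
            cv (fun η => sn (F s η)) (fun η => sn (G s η)) ξ := by
    intro j
    rw [intervalIntegral.integral_of_le ht.le, integral_Ioc_eq_integral_Ioo,
      ← lintegral_const_mul' _ _ ENNReal.ofReal_ne_top]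
    refine (enorm_integral_le_lintegral_enorm _).trans (lintegral_mono fun s => ?_)
    rw [enorm_mul, ← ofReal_norm, Complex.norm_real, Real.norm_of_nonneg (Real.exp_pos _).le]
    refine (mul_le_mul_right (h (F s) (G s) ξ j) _).trans (le_of_eq ?_)
    rw [← mul_assoc, ← mul_assoc, ← ENNReal.ofReal_mul (by positivity),
      ← ENNReal.ofReal_mul (by positivity)]
    congr 2; ring
  rw [sn_eq_sum]
  refine (Finset.sum_le_sum fun j _ => hj j).trans (le_of_eq ?_)
  rw [ENNReal.ofReal_mul (by norm_num)]
  simp [mul_assoc]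

/-- The bilinear estimate at a fixed positive time. -/
lemma exists_bilinear_time_le (α : Coeffs) {δ γ : ℝ} (hδ : 0 < δ) (hδ1 : δ < 1 / 8)
    (hγ : 1 / 2 + 2 * δ < γ) :
    ∃ C > (0 : ℝ), ∀ T lam N t : ℝ, 0 < T → 10 ≤ lam → N = lam * T ^ (-(1 : ℝ) / 2) → 0 < t → t ≤ T →
      ∀ F G : ℝ → V3 → Fin 3 → ℂ, MeasVF F → MeasVF G →
      l2n (fun ξ => ENNReal.ofReal (if 0.1 * N ≤ en ξ then t ^ (δ / 2) * en ξ ^ (δ + 1 / 2) *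
              Real.exp (N * t * en ξ - N ^ 2 * t / 4) else 0) *
            sn (fun j => ∫ s in (0 : ℝ)..t,
              (Real.exp (-((t - s) * en ξ ^ 2)) : ℂ) * Qhat α (F s) (G s) ξ j))
        ≤ ENNReal.ofReal C *
          (ENNReal.ofReal (lam ^ (-δ) * Real.exp (lam ^ 2 / 4)) *
              (Xnorm δ lam T F * Xnorm δ lam T G) +
            ENNReal.ofReal (lam ^ ((2 : ℝ) - δ) * T ^ (δ / 2) *
                (1 + lam ^ (1 / 2 + δ + γ) * T ^ ((γ - 1 / 2 - δ) / 2) *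
                  Real.exp (0.01 * lam ^ 2))) *
              (supH γ T G * Xnorm δ lam T F + supH γ T F * Xnorm δ lam T G)) := by
  obtain ⟨C0, hC0, hduh⟩ := exists_sn_duhamel_le α
  obtain ⟨C1, hC1, hsp⟩ := exists_l2n_bilinear_le hδ hδ1 hγ
  obtain ⟨C2, hC2, hthh⟩ := exists_time_high_high (c := 0.1) hδ (by linarith) (by norm_num)
  obtain ⟨C3, hC3, htlh⟩ := exists_time_low_high hδ (by linarith)
  refine ⟨C0 * (9 * C1 * (C2 + C3)), by positivity,
    fun T lam N t hT hlam hN ht htT F G hF hG => ?_⟩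
  have hl : 0 < lam := by linarith
  have hN0 : 0 < N := by rw [hN]; positivity
  have hNT : N ^ 2 * T = lam ^ 2 := by
    rw [hN, mul_pow, mul_assoc, ← Real.rpow_natCast (T ^ _), ← Real.rpow_mul hT.le,
      ← Real.rpow_add_one hT.ne']
    norm_num
  have hlam2 : 100 ≤ lam ^ 2 := by nlinarith
  set f : ℝ × V3 → ℝ≥0∞ := fun p => sn (F p.1 p.2) with hf
  set g : ℝ × V3 → ℝ≥0∞ := fun p => sn (G p.1 p.2) with hg
  have hfm : Measurable f := measurable_sn_uncurry hF
  have hgm : Measurable g := measurable_sn_uncurry hG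
  have hcm := measurable_cv_uncurry hfm hgm
  set K : ℝ → V3 → ℝ≥0∞ := fun s ξ => if 0.1 * N ≤ en ξ then
          ENNReal.ofReal (t ^ (δ / 2) * en ξ ^ (δ + 1 / 2) * Real.exp (N * t * en ξ - N ^ 2 * t / 4) *
            (Real.exp (-((t - s) * en ξ ^ 2)) * en ξ)) *
              cv (fun η => f (s, η)) (fun η => g (s, η)) ξ else 0 with hK
  have hKm : Measurable (Function.uncurry K) :=
    Measurable.ite (p := fun q : ℝ × V3 => 0.1 * N ≤ en q.2)
      (measurableSet_le (by fun_prop) (by fun_prop)) (by fun_prop) (by fun_prop)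
  have hpt : ∀ ξ, ENNReal.ofReal (if 0.1 * N ≤ en ξ then t ^ (δ / 2) * en ξ ^ (δ + 1 / 2) *
              Real.exp (N * t * en ξ - N ^ 2 * t / 4) else 0) *
            sn (fun j => ∫ s in (0 : ℝ)..t,
              (Real.exp (-((t - s) * en ξ ^ 2)) : ℂ) * Qhat α (F s) (G s) ξ j)
      ≤ ENNReal.ofReal C0 * ∫⁻ s in Ioo 0 t, K s ξ := by
    intro ξ
    have h0 := en_nonneg ξ
    by_cases hξ : 0.1 * N ≤ en ξ
    · simp only [hK, hξ, if_true]
      refine (mul_le_mul_right (hduh t ht F G ξ) _).trans (le_of_eq ?_)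
      rw [mul_left_comm, ← lintegral_const_mul' _ _ ENNReal.ofReal_ne_top]
      congr 1
      refine lintegral_congr fun s => ?_
      rw [← mul_assoc, ← ENNReal.ofReal_mul (by positivity)]
    · simp [hξ]
  refine (l2n_mono hpt).trans ?_
  have hIm : Measurable (fun ξ => ∫⁻ s in Ioo 0 t, K s ξ) :=
    Measurable.lintegral_prod_left' (f := Function.uncurry K) hKm
  rw [l2n_const_mul _ hIm,
    ENNReal.ofReal_mul hC0.le, mul_assoc]
  refine mul_le_mul_right ((l2n_lintegral_le hKm).trans ?_) _
  set XX := Xnorm δ lam T F * Xnorm δ lam T G with hXX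
  set HX := supH γ T G * Xnorm δ lam T F + supH γ T F * Xnorm δ lam T G with hHX
  set a : ℝ → ℝ := fun s => t ^ (δ / 2) * s ^ (-δ) * (t - s) ^ (-(1 - δ / 2)) *
              Real.exp (-(0.1 * (N ^ 2 * (t - s)))) * Real.exp (N ^ 2 * t / 4) with ha
  set b : ℝ → ℝ := fun s => t ^ (δ / 2) * s ^ (-(δ / 2)) * (N + (t - s) ^ (-(1 / 2 : ℝ))) with hb
  set D := (N * T) ^ (-(1 - δ)) + Real.exp (0.01 * (N * (N * T))) * N ^ (3 / 2 - γ) with hD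
  have hD0 : 0 ≤ D := by positivity
  have ham : Measurable a := by fun_prop
  have hbm : Measurable b := by fun_prop
  have hKs : ∀ s ∈ Ioo 0 t, l2n (K s) ≤ ENNReal.ofReal (9 * C1) * XX * ENNReal.ofReal (a s) +
      ENNReal.ofReal (9 * C1 * D) * HX * ENNReal.ofReal (b s) := by
    intro s hs
    have hsT : s ∈ Icc 0 T := ⟨hs.1.le, (hs.2.trans_le htT).le⟩
    have h1 := hsp N s t (N * T) hN0 hs.1 hs.2
      (by rw [show N * (N * T) = N ^ 2 * T by ring, hNT]; linarith)
      (by have := hsT.2; gcongr) (fun η => f (s, η)) (fun η => g (s, η))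
      (by fun_prop) (by fun_prop)
    refine h1.trans ?_
    have hXF := l2n_xw_le_Xnorm (δ := δ) (lam := lam) hT hsT F
    have hXG := l2n_xw_le_Xnorm (δ := δ) (lam := lam) hT hsT G
    rw [← hN] at hXF hXG
    have hHF := l2n_wH_le_supH (γ := γ) hsT F
    have hHG := l2n_wH_le_supH (γ := γ) hsT G
    have h9 : ENNReal.ofReal (9 : ℝ) = 9 := by simp
    refine (add_le_add (mul_le_mul_right (mul_le_mul' hXF hXG) _) (mul_le_mul_right
      (add_le_add (mul_le_mul' hHF hXG) (mul_le_mul' hXF hHG)) _)).trans (le_of_eq ?_)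
    rw [ENNReal.ofReal_mul hC1.le, ENNReal.ofReal_mul (mul_nonneg hC1.le hD0),
      ENNReal.ofReal_mul hC1.le, ENNReal.ofReal_mul (by positivity : (0 : ℝ) ≤ 9 * C1),
      ENNReal.ofReal_mul (by norm_num : (0 : ℝ) ≤ 9), h9]
    ring
  refine (setLIntegral_mono (by fun_prop) hKs).trans ?_
  rw [lintegral_add_left (by fun_prop), lintegral_const_mul _ (by fun_prop),
    lintegral_const_mul _ (by fun_prop),
    mul_add (ENNReal.ofReal (9 * C1 * (C2 + C3)))]
  have e1 := hthh t T N lam ht htT hN0 (by linarith) hNT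
  have e2 := htlh t T N ht htT hN0 (by rw [hNT]; linarith)
  have e3 := low_high_coeff_le (γ := γ) (by linarith : δ ≤ 1) (by linarith) hT (by linarith) hN
  refine add_le_add ((mul_le_mul_right e1 _).trans ?_) ((mul_le_mul_right e2 _).trans ?_)
  · rw [mul_right_comm, ← ENNReal.ofReal_mul (by positivity), ← mul_assoc _ _ XX,
      ← ENNReal.ofReal_mul (by positivity)]
    refine mul_le_mul_left (ENNReal.ofReal_le_ofReal ?_) _
    rw [← mul_assoc]
    gcongr
    linarith
  · rw [mul_right_comm, ← ENNReal.ofReal_mul (by positivity), ← mul_assoc _ _ HX,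
      ← ENNReal.ofReal_mul (by positivity)]
    refine mul_le_mul_left (ENNReal.ofReal_le_ofReal ?_) _
    calc 9 * C1 * D * (C3 * (N * T)) = 9 * C1 * C3 * (D * (N * T)) := by ring
      _ ≤ 9 * C1 * (C2 + C3) * (D * (N * T)) := by
        gcongr
        linarith
      _ ≤ _ := by gcongr

/-- Proposition 2.1: the main bilinear estimate. -/
theorem statement4 (α : Coeffs) :
    ∃ δ₀ > (0 : ℝ), ∃ η₁ > (0 : ℝ), ∀ δ γ η₀ : ℝ,
      0 < δ → δ < δ₀ → 1 / 2 + 2 * δ < γ → 0 < η₀ → η₀ < η₁ →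
      ∃ C > (0 : ℝ), ∀ T lam : ℝ, 0 < T → T ≤ 1 → 10 ≤ lam →
        ∀ F G : ℝ → V3 → Fin 3 → ℂ, MeasVF F → MeasVF G →
          supH γ T F < ⊤ → supH γ T G < ⊤ → Xnorm δ lam T F < ⊤ → Xnorm δ lam T G < ⊤ →
          (⨆ t ∈ Icc (0 : ℝ) T,
              wnorm (fun ξ => if 0.1 * (lam * T ^ (-(1 : ℝ) / 2)) ≤ en ξ then
                  t ^ (δ / 2) * en ξ ^ (δ + 1 / 2) *
                    Real.exp (lam * t / Real.sqrt T * en ξ - lam ^ 2 * t / (4 * T))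
                else 0)
                (fun ξ j => ∫ s in (0 : ℝ)..t,
                  (Real.exp (-((t - s) * en ξ ^ 2)) : ℂ) * Qhat α (F s) (G s) ξ j))
            ≤ ENNReal.ofReal C *
              (ENNReal.ofReal ((Real.exp (4 * η₀ * lam ^ 2) + lam ^ (-δ)) *
                    lam ^ (-(γ - 1 / 2 + δ)) * T ^ ((γ - 1 / 2 + 2 * δ) / 2)) *
                  (supH γ T F * supH γ T (highPart (lam * T ^ (-(1 : ℝ) / 2)) G) +
                    supH γ T (highPart (lam * T ^ (-(1 : ℝ) / 2)) F) * supH γ T G) +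
                ENNReal.ofReal (lam ^ (-δ) * Real.exp (lam ^ 2 / 4)) *
                  (Xnorm δ lam T F * Xnorm δ lam T G) +
                ENNReal.ofReal (lam ^ ((2 : ℝ) - δ) * T ^ (δ / 2) *
                    (1 + lam ^ (1 / 2 + δ + γ) * T ^ ((γ - 1 / 2 - δ) / 2) *
                      Real.exp (0.01 * lam ^ 2))) *
                  (supH γ T G * Xnorm δ lam T F + supH γ T F * Xnorm δ lam T G)) := by
  refine ⟨1 / 8, by norm_num, 1, one_pos, fun δ γ η₀ hδ hδ1 hγ _ _ => ?_⟩
  obtain ⟨C, hC, h⟩ := exists_bilinear_time_le α hδ hδ1 hγ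
  refine ⟨C, hC, fun T lam hT _ hlam F G hF hG _ _ _ _ => iSup₂_le fun t ht => ?_⟩
  rcases ht.1.eq_or_lt with rfl | ht0
  · rw [Real.zero_rpow (by positivity)]
    simp [wnorm]
  · simp only [lam_mul_div_sqrt lam t _ hT, lam_sq_mul_div lam t hT]
    refine (wnorm_le_l2n (fun ξ => ?_) _).trans ((h T lam _ t hT hlam rfl ht0 ht.2 F G hF hG).trans
      (mul_le_mul_right ?_ _))
    · have := en_nonneg ξ
      split_ifs <;> positivity
    · exact add_le_add le_add_self le_rfl
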